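/- arXiv:1909.10905 — 4 statements merged into one kernel-verified Lean document; each statement's English description precedes it below -/
import Mathlib

section
/- For n ≥ 2 and a nonzero integer k, the monoids B^{⊕k}(∞,∞,n) and B^{⊕1}(∞,∞,n) are isomorphic if and only if k = 1 or k = −1. -/
/-- Index type for the generators `s̃_3, …, s̃_n`. -/
abbrev SIdx (n : ℕ) := {j : ℕ // 3 ≤ j ∧ j ≤ n}

/-- Generators of the Corran–Lee–Lee type presentations: `t̃_i` (`i ∈ ℤ`) and `s̃_j`
(`3 ≤ j ≤ n`). -/
abbrev Gen (n : ℕ) := ℤ ⊕ SIdx n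

/-- The generator `t̃_i` as an element of the free monoid. -/
def tw (n : ℕ) (i : ℤ) : FreeMonoid (Gen n) := FreeMonoid.of (Sum.inl i)

/-- The generator `s̃_j` as an element of the free monoid. -/
def sw (n : ℕ) (j : SIdx n) : FreeMonoid (Gen n) := FreeMonoid.of (Sum.inr j)

/-- The defining relations of the monoid `B^{⊕k}(∞,∞,n)`. -/
inductive BRel (n : ℕ) (k : ℤ) : FreeMonoid (Gen n) → FreeMonoid (Gen n) → Prop
  | braid (i j : SIdx n) (h : i.val + 1 = j.val ∨ j.val + 1 = i.val) :
      BRel n k (sw n i * sw n j * sw n i) (sw n j * sw n i * sw n j)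
  | comm (i j : SIdx n) (h : i.val + 1 < j.val ∨ j.val + 1 < i.val) :
      BRel n k (sw n i * sw n j) (sw n j * sw n i)
  | ts3 (i : ℤ) (s3 : SIdx n) (h : s3.val = 3) :
      BRel n k (sw n s3 * tw n i * sw n s3) (tw n i * sw n s3 * tw n i)
  | tsj (i : ℤ) (j : SIdx n) (h : 4 ≤ j.val) :
      BRel n k (sw n j * tw n i) (tw n i * sw n j)
  | tt (i j : ℤ) :
      BRel n k (tw n i * tw n (i - k)) (tw n j * tw n (j - k))

/-- The monoid `B^{⊕k}(∞,∞,n)`, presented by the generators `Gen n` and the relations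
`BRel n k`. -/
abbrev BMon (n : ℕ) (k : ℤ) := (conGen (BRel n k)).Quotient

/-- The image in `B^{⊕k}(∞,∞,n)` of a word in the generators. -/
def bmk (n : ℕ) (k : ℤ) : FreeMonoid (Gen n) →* BMon n k := (conGen (BRel n k)).mk'

/-- The words `t̃_i t̃_{i-k}`. -/
def IsTTWord (n : ℕ) (k : ℤ) (u : List (Gen n)) : Prop :=
  ∃ i : ℤ, u = [Sum.inl i, Sum.inl (i - k)]

/-- Two words agree up to the relations of length two: they are both of the form `t̃_i t̃_{i-k}`,
or neither is and they agree up to reversal. -/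
def ShortRel (n : ℕ) (k : ℤ) (u v : List (Gen n)) : Prop :=
  (IsTTWord n k u ∧ IsTTWord n k v) ∨
    (¬ IsTTWord n k u ∧ ¬ IsTTWord n k v ∧ (u = v ∨ u.reverse = v))

theorem ShortRel.refl (n : ℕ) (k : ℤ) (u : List (Gen n)) : ShortRel n k u u := by
  unfold ShortRel; tauto

theorem ShortRel.symm {n : ℕ} {k : ℤ} {u v : List (Gen n)} (h : ShortRel n k u v) :
    ShortRel n k v u := by
  rcases h with h | ⟨h1, h2, rfl | rfl⟩
  · exact Or.inl h.symm
  · exact ShortRel.refl n k _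
  · exact Or.inr ⟨h2, h1, Or.inr (List.reverse_reverse _)⟩

theorem ShortRel.trans {n : ℕ} {k : ℤ} {u v w : List (Gen n)} (h : ShortRel n k u v)
    (h' : ShortRel n k v w) : ShortRel n k u w := by
  rcases h with ⟨h1, h2⟩ | ⟨h1, h2, rfl | rfl⟩ <;>
    rcases h' with ⟨h3, h4⟩ | ⟨h3, h4, rfl | rfl⟩ <;>
    simp_all [ShortRel]

theorem ShortRel.eq_of_length_le_one {n : ℕ} {k : ℤ} {u v : List (Gen n)}
    (h : ShortRel n k u v) (hu : u.length ≤ 1) : u = v := by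
  rcases h with ⟨⟨i, rfl⟩, _⟩ | ⟨-, -, rfl | rfl⟩
  · simp at hu
  · rfl
  · match u, hu with
    | [], _ => rfl
    | [a], _ => rfl

/-- The congruence identifying words of equal length, and distinguishing words of length at
most two up to `ShortRel`. -/
def shortCon (n : ℕ) (k : ℤ) : Con (FreeMonoid (Gen n)) where
  r u v := u.toList.length = v.toList.length ∧
    (u.toList.length ≤ 2 → ShortRel n k u.toList v.toList)
  iseqv :=
    { refl := fun _ => ⟨rfl, fun _ => ShortRel.refl n k _⟩
      symm := fun h => ⟨h.1.symm, fun hl => (h.2 (h.1.trans_le hl)).symm⟩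
      trans := fun h h' => ⟨h.1.trans h'.1, fun hl =>
        (h.2 hl).trans (h'.2 (h.1.symm.trans_le hl))⟩ }
  mul' := by
    intro w x y z h h'
    simp only [FreeMonoid.toList_mul, List.length_append]
    refine ⟨by omega, fun hl => ?_⟩
    rcases Nat.eq_zero_or_pos w.toList.length with hw | hw
    · have hx : x.toList.length = 0 := h.1.symm.trans hw
      rw [List.length_eq_zero_iff] at hw hx
      simpa [hw, hx] using h'.2 (by omega)
    rcases Nat.eq_zero_or_pos y.toList.length with hy | hy
    · have hz : z.toList.length = 0 := h'.1.symm.trans hy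
      rw [List.length_eq_zero_iff] at hy hz
      simpa [hy, hz] using h.2 (by omega)
    rw [(h.2 (by omega)).eq_of_length_le_one (by omega),
      (h'.2 (by omega)).eq_of_length_le_one (by omega)]
    exact ShortRel.refl n k _

theorem shortCon_of_bmk_eq {n : ℕ} {k : ℤ} {u v : FreeMonoid (Gen n)}
    (h : bmk n k u = bmk n k v) : shortCon n k u v := by
  refine Con.conGen_le.2 ?_ ((Con.eq _).1 h)
  intro u v huv
  show u.toList.length = v.toList.length ∧
    (u.toList.length ≤ 2 → ShortRel n k u.toList v.toList)
  cases huv with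
  | braid i j h => simp [sw]
  | comm i j h => simp [sw, ShortRel, IsTTWord]
  | ts3 i s3 h => simp [sw, tw]
  | tsj i j h => simp [sw, tw, ShortRel, IsTTWord]
  | tt i j => simp [tw, ShortRel, IsTTWord]

theorem length_eq_of_bmk_eq {n : ℕ} {k : ℤ} {u v : FreeMonoid (Gen n)}
    (h : bmk n k u = bmk n k v) : u.toList.length = v.toList.length :=
  (shortCon_of_bmk_eq h).1

theorem shortRel_of_bmk_eq {n : ℕ} {k : ℤ} {u v : FreeMonoid (Gen n)}
    (h : bmk n k u = bmk n k v) (hu : u.toList.length ≤ 2) :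
    ShortRel n k u.toList v.toList :=
  (shortCon_of_bmk_eq h).2 hu

theorem bmk_surjective (n : ℕ) (k : ℤ) : Function.Surjective (bmk n k) :=
  Con.mk'_surjective

theorem bmk_of_injective (n : ℕ) (k : ℤ) :
    Function.Injective fun g : Gen n => bmk n k (FreeMonoid.of g) := by
  intro a b h
  simpa using (shortRel_of_bmk_eq h (by simp)).eq_of_length_le_one (by simp)

theorem isUnit_bmk_iff {n : ℕ} {k : ℤ} {u : FreeMonoid (Gen n)} :
    IsUnit (bmk n k u) ↔ u = 1 := by
  constructor
  · intro h
    obtain ⟨y, hy⟩ := h.exists_right_inv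
    obtain ⟨v, rfl⟩ := bmk_surjective n k y
    have := length_eq_of_bmk_eq (v := 1) (by rw [map_mul, hy, map_one])
    simp only [FreeMonoid.toList_mul, List.length_append, FreeMonoid.toList_one,
      List.length_nil] at this
    exact FreeMonoid.toList.injective (List.length_eq_zero_iff.1 (by omega))
  · rintro rfl
    simp

theorem irreducible_bmk_of (n : ℕ) (k : ℤ) (g : Gen n) :
    Irreducible (bmk n k (FreeMonoid.of g)) := by
  refine ⟨fun h => FreeMonoid.of_ne_one g (isUnit_bmk_iff.1 h), fun {a b} h => ?_⟩
  obtain ⟨u, rfl⟩ := bmk_surjective n k a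
  obtain ⟨v, rfl⟩ := bmk_surjective n k b
  rw [← map_mul] at h
  have := length_eq_of_bmk_eq h
  simp only [FreeMonoid.toList_mul, List.length_append, FreeMonoid.toList_of,
    List.length_singleton] at this
  rw [isUnit_bmk_iff, isUnit_bmk_iff]
  rcases Nat.eq_zero_or_pos u.toList.length with hu | hu
  · exact Or.inl (FreeMonoid.toList.injective (List.length_eq_zero_iff.1 hu))
  · exact Or.inr (FreeMonoid.toList.injective (List.length_eq_zero_iff.1 (by omega)))

theorem exists_of_irreducible {n : ℕ} {k : ℤ} {x : BMon n k} (hx : Irreducible x) :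
    ∃ g, x = bmk n k (FreeMonoid.of g) := by
  obtain ⟨u, rfl⟩ := bmk_surjective n k x
  induction u using FreeMonoid.casesOn with
  | one => exact absurd (isUnit_bmk_iff.2 rfl) hx.not_isUnit
  | of_mul g w =>
    rcases hx.isUnit_or_isUnit (map_mul (bmk n k) _ _) with h | h
    · exact absurd (isUnit_bmk_iff.1 h) (FreeMonoid.of_ne_one g)
    · exact ⟨g, by rw [isUnit_bmk_iff.1 h, mul_one]⟩

/-- The product `a * b` of two irreducibles has a factorization into irreducibles whose first
factor is neither `a` nor `b`. -/
def Refactors {M : Type*} [Monoid M] (a b : M) : Prop :=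
  Irreducible a ∧ Irreducible b ∧
    ∃ c d : M, Irreducible c ∧ Irreducible d ∧ a * b = c * d ∧ c ≠ a ∧ c ≠ b

theorem Refactors.map {M N : Type*} [Monoid M] [Monoid N] (e : M ≃* N) {a b : M}
    (h : Refactors a b) : Refactors (e a) (e b) := by
  obtain ⟨ha, hb, c, d, hc, hd, h, h1, h2⟩ := h
  exact ⟨(MulEquiv.irreducible_iff e).2 ha, (MulEquiv.irreducible_iff e).2 hb, e c, e d,
    (MulEquiv.irreducible_iff e).2 hc, (MulEquiv.irreducible_iff e).2 hd,
    by rw [← map_mul, h, map_mul], e.injective.ne h1, e.injective.ne h2⟩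

theorem bmk_tw_injective (n : ℕ) (k : ℤ) :
    Function.Injective fun i : ℤ => bmk n k (tw n i) :=
  (bmk_of_injective n k).comp Sum.inl_injective

theorem bmk_tt (n : ℕ) (k i j : ℤ) :
    bmk n k (tw n i) * bmk n k (tw n (i - k)) = bmk n k (tw n j) * bmk n k (tw n (j - k)) := by
  rw [← map_mul, ← map_mul]
  exact (Con.eq _).2 (ConGen.Rel.of _ _ (BRel.tt i j))

theorem refactors_tw (n : ℕ) (k i : ℤ) :
    Refactors (bmk n k (tw n i)) (bmk n k (tw n (i - k))) := by
  refine ⟨irreducible_bmk_of _ _ _, irreducible_bmk_of _ _ _, bmk n k (tw n (|i| + |k| + 1)),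
    bmk n k (tw n (|i| + |k| + 1 - k)), irreducible_bmk_of _ _ _, irreducible_bmk_of _ _ _,
    bmk_tt n k _ _, (bmk_tw_injective n k).ne ?_, (bmk_tw_injective n k).ne ?_⟩
  · have := le_abs_self i
    have := abs_nonneg k
    omega
  · have := le_abs_self i
    have := neg_le_abs k
    omega

theorem Refactors.exists_tw {n : ℕ} {k : ℤ} {a b : BMon n k} (h : Refactors a b) :
    ∃ i, a = bmk n k (tw n i) ∧ b = bmk n k (tw n (i - k)) := by
  obtain ⟨ha, hb, c, d, hc, hd, h, h1, h2⟩ := h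
  obtain ⟨a, rfl⟩ := exists_of_irreducible ha
  obtain ⟨b, rfl⟩ := exists_of_irreducible hb
  obtain ⟨c, rfl⟩ := exists_of_irreducible hc
  obtain ⟨d, rfl⟩ := exists_of_irreducible hd
  rw [← map_mul, ← map_mul] at h
  have := shortRel_of_bmk_eq h (by simp)
  simp only [FreeMonoid.toList_mul, FreeMonoid.toList_of, List.cons_append,
    List.nil_append] at this
  rcases this with ⟨⟨i, hi⟩, -⟩ | ⟨-, -, h | h⟩
  · simp only [List.cons.injEq, and_true] at hi
    exact ⟨i, by rw [hi.1]; rfl, by rw [hi.2]; rfl⟩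
  · simp only [List.cons.injEq] at h
    exact absurd (by rw [h.1]) h1
  · simp only [List.reverse_cons, List.reverse_nil, List.nil_append, List.cons_append,
      List.cons.injEq] at h
    exact absurd (by rw [h.1]) h2

theorem dvd_one_of_mulEquiv {n : ℕ} {k : ℤ} (e : BMon n k ≃* BMon n 1) : k ∣ 1 := by
  have key : ∀ i, ∃ j, e.symm (bmk n 1 (tw n i)) = bmk n k (tw n j) ∧
      e.symm (bmk n 1 (tw n (i - 1))) = bmk n k (tw n (j - k)) := fun i =>
    ((refactors_tw n 1 i).map e.symm).exists_tw
  choose σ hσ hσ' using key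
  have step : ∀ i, σ (i - 1) = σ i - k := fun i =>
    bmk_tw_injective n k ((hσ (i - 1)).symm.trans (hσ' i))
  have lin : ∀ i, k ∣ σ i - σ 0 := by
    intro i
    induction i using Int.induction_on with
    | zero => simp
    | succ i ih =>
      have := step (i + 1)
      rw [add_sub_cancel_right] at this
      rw [show σ (i + 1) - σ 0 = (σ i - σ 0) + k by rw [this]; ring]
      exact dvd_add ih dvd_rfl
    | pred i ih =>
      rw [step, sub_right_comm]
      exact dvd_sub ih dvd_rfl
  obtain ⟨m, hm, -⟩ := ((refactors_tw n k (σ 0 + 1)).map e).exists_tw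
  have hm' : σ m = σ 0 + 1 :=
    bmk_tw_injective n k ((hσ m).symm.trans (by rw [← hm, e.symm_apply_apply]))
  simpa [hm'] using lin m

/-- Negating the indices of the `t̃_i` gives a homomorphism from `B^{⊕k}(∞,∞,n)` to
`B^{⊕(-k)}(∞,∞,n)`. -/
def negHom (n : ℕ) (k l : ℤ) (h : l = -k) : BMon n k →* BMon n l :=
  (conGen (BRel n k)).lift
    ((bmk n l).comp (FreeMonoid.map (Sum.map Neg.neg id))) <| by
    subst h
    refine Con.conGen_le.2 fun u v huv => (Con.eq _).2 (ConGen.Rel.of _ _ ?_)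
    cases huv with
    | braid i j h => exact BRel.braid i j h
    | comm i j h => exact BRel.comm i j h
    | ts3 i s3 h => exact BRel.ts3 (-i) s3 h
    | tsj i j h => exact BRel.tsj (-i) j h
    | tt i j =>
      have := BRel.tt (n := n) (k := -k) (-i) (-j)
      rw [show -i - -k = -(i - k) by ring, show -j - -k = -(j - k) by ring] at this
      exact this

theorem negHom_comp (n : ℕ) (k l : ℤ) (h : l = -k) (h' : k = -l) :
    (negHom n l k h').comp (negHom n k l h) = MonoidHom.id _ := by
  refine Con.hom_ext (FreeMonoid.hom_eq fun g => ?_)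
  show bmk n k (FreeMonoid.of (Sum.map Neg.neg id (Sum.map Neg.neg id g))) =
    bmk n k (FreeMonoid.of g)
  cases g <;> simp

/-- `B^{⊕k}(∞,∞,n)` is isomorphic to `B^{⊕1}(∞,∞,n)` iff `k = ±1`. -/
theorem stmt_12 (n : ℕ) (hn : 2 ≤ n) (k : ℤ) (hk : k ≠ 0) :
    Nonempty (BMon n k ≃* BMon n 1) ↔ k = 1 ∨ k = -1 := by
  constructor
  · rintro ⟨e⟩
    exact Int.isUnit_iff.1 (isUnit_of_dvd_one (dvd_one_of_mulEquiv e))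
  · rintro (rfl | rfl)
    · exact ⟨MulEquiv.refl _⟩
    · exact ⟨MonoidHom.toMulEquiv (negHom n (-1) 1 rfl) (negHom n 1 (-1) rfl)
        (negHom_comp n _ _ _ _) (negHom_comp n _ _ _ _)⟩
end

section
/- For every n ≥ 3 and every nonzero integer k, there is an injective group homomorphism from the Artin group B(B_{n−1}) of type B_{n−1} to the group B^{(k)}(∞,∞,n) sending q_1 to t̃_k·t̃_0 and q_{j−1} to s̃_j for 3 ≤ j ≤ n. -/
/-- The generator `t̃_i` as an element of the free group. -/
def gt (n : ℕ) (i : ℤ) : FreeGroup (Gen n) := FreeGroup.of (Sum.inl i)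

/-- The generator `s̃_j` as an element of the free group. -/
def gs (n : ℕ) (j : SIdx n) : FreeGroup (Gen n) := FreeGroup.of (Sum.inr j)

/-- The defining relators of the group `B^{(k)}(∞,∞,n)`. -/
def BRels (n : ℕ) (k : ℤ) : Set (FreeGroup (Gen n)) :=
  {r | (∃ i j : SIdx n, (i.val + 1 = j.val ∨ j.val + 1 = i.val) ∧
          r = gs n i * gs n j * gs n i * (gs n j * gs n i * gs n j)⁻¹) ∨
       (∃ i j : SIdx n, (i.val + 1 < j.val ∨ j.val + 1 < i.val) ∧
          r = gs n i * gs n j * (gs n j * gs n i)⁻¹) ∨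
       (∃ (i : ℤ) (s3 : SIdx n), s3.val = 3 ∧
          r = gs n s3 * gt n i * gs n s3 * (gt n i * gs n s3 * gt n i)⁻¹) ∨
       (∃ (i : ℤ) (j : SIdx n), 4 ≤ j.val ∧
          r = gs n j * gt n i * (gt n i * gs n j)⁻¹) ∨
       (∃ i j : ℤ, r = gt n i * gt n (i - k) * (gt n j * gt n (j - k))⁻¹)}

/-- The group `B^{(k)}(∞,∞,n)`, presented by the generators `Gen n` and the relators
`BRels n k`.  `B(∞,∞,n) = BGrp n 1` is the Corran–Lee–Lee presentation. -/
abbrev BGrp (n : ℕ) (k : ℤ) := PresentedGroup (BRels n k)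

/-- The generator `t̃_i` of `B^{(k)}(∞,∞,n)`. -/
def bgt (n : ℕ) (k : ℤ) (i : ℤ) : BGrp n k := PresentedGroup.of (Sum.inl i)

/-- The generator `s̃_j` of `B^{(k)}(∞,∞,n)`. -/
def bgs (n : ℕ) (k : ℤ) (j : SIdx n) : BGrp n k := PresentedGroup.of (Sum.inr j)

/-- Index type for the generators `q_1, …, q_{n-1}` of the Artin group of type `B_{n-1}`. -/
abbrev QIdx (n : ℕ) := {i : ℕ // 1 ≤ i ∧ i ≤ n - 1}

/-- The generator `q_i` as an element of the free group. -/
def gq (n : ℕ) (i : QIdx n) : FreeGroup (QIdx n) := FreeGroup.of i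

/-- The defining relators of the Artin group `B(B_{n-1})` of type `B_{n-1}`:
`q_1q_2q_1q_2 = q_2q_1q_2q_1`, `q_iq_{i+1}q_i = q_{i+1}q_iq_{i+1}` for `2 ≤ i ≤ n-2`,
and `q_iq_j = q_jq_i` for `|i-j| > 1`. -/
def ArtinBRels (n : ℕ) : Set (FreeGroup (QIdx n)) :=
  {r | (∃ i j : QIdx n, i.val = 1 ∧ j.val = 2 ∧
          r = gq n i * gq n j * gq n i * gq n j * (gq n j * gq n i * gq n j * gq n i)⁻¹) ∨
       (∃ i j : QIdx n, 2 ≤ i.val ∧ j.val = i.val + 1 ∧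
          r = gq n i * gq n j * gq n i * (gq n j * gq n i * gq n j)⁻¹) ∨
       (∃ i j : QIdx n, (i.val + 1 < j.val ∨ j.val + 1 < i.val) ∧
          r = gq n i * gq n j * (gq n j * gq n i)⁻¹)}

/-- The Artin group `B(B_{n-1})` of type `B_{n-1}`. -/
abbrev ArtinB (n : ℕ) := PresentedGroup (ArtinBRels n)

namespace ArtinB

/-- The generators `q_i` of `ArtinB n`, extended by `1` outside the index range. -/
def q (n i : ℕ) : ArtinB n :=
  if h : 1 ≤ i ∧ i ≤ n - 1 then PresentedGroup.of ⟨i, h⟩ else 1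

theorem q_of_mem {n i : ℕ} (h : 1 ≤ i ∧ i ≤ n - 1) :
    q n i = PresentedGroup.of ⟨i, h⟩ := dif_pos h

theorem q_four_braid {n : ℕ} (hn : 3 ≤ n) :
    q n 1 * q n 2 * q n 1 * q n 2 = q n 2 * q n 1 * q n 2 * q n 1 := by
  rw [q_of_mem (by omega), q_of_mem (by omega)]
  exact PresentedGroup.mk_eq_mk_of_mul_inv_mem (Or.inl ⟨_, _, rfl, rfl, rfl⟩)

theorem q_braid {n i : ℕ} (hi : 2 ≤ i) (hin : i + 1 ≤ n - 1) :
    q n i * q n (i + 1) * q n i = q n (i + 1) * q n i * q n (i + 1) := by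
  rw [q_of_mem (by omega), q_of_mem (by omega)]
  exact PresentedGroup.mk_eq_mk_of_mul_inv_mem (Or.inr (Or.inl ⟨_, _, hi, rfl, rfl⟩))

theorem q_comm {n i j : ℕ} (h : i + 1 < j) : Commute (q n i) (q n j) := by
  by_cases hi : 1 ≤ i ∧ i ≤ n - 1
  · by_cases hj : 1 ≤ j ∧ j ≤ n - 1
    · rw [q_of_mem hi, q_of_mem hj]
      exact PresentedGroup.mk_eq_mk_of_mul_inv_mem (Or.inr (Or.inr ⟨_, _, Or.inl h, rfl⟩))
    · rw [q, q, dif_neg hj]; exact Commute.one_right _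
  · rw [q, dif_neg hi]; exact Commute.one_left _

/-- The conjugate `q_1^{-m} q_2 q_1^m`. -/
def conjTwo (n : ℕ) (m : ℤ) : ArtinB n := q n 1 ^ (-m) * q n 2 * q n 1 ^ m

theorem conjTwo_comm {n j : ℕ} (m : ℤ) (hj : 4 ≤ j) : Commute (conjTwo n m) (q n j) :=
  (((q_comm (by omega)).zpow_left _).mul_left (q_comm (by omega))).mul_left
    ((q_comm (by omega)).zpow_left _)

theorem conjTwo_braid {n : ℕ} (hn : 4 ≤ n) (m : ℤ) :
    q n 3 * conjTwo n m * q n 3 = conjTwo n m * q n 3 * conjTwo n m := by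
  have hc : Commute (q n 1 ^ m) (q n 3) := (q_comm (by omega)).zpow_left m
  have hb := q_braid (n := n) (i := 2) le_rfl (by omega)
  have h3 : q n 3 = q n 1 ^ (-m) * q n 3 * q n 1 ^ m := by
    rw [mul_assoc, ← hc.eq, zpow_neg, inv_mul_cancel_left]
  rw [h3, conjTwo]
  calc _ = q n 1 ^ (-m) * (q n 3 * q n 2 * q n 3) * q n 1 ^ m := by group
    _ = q n 1 ^ (-m) * (q n 2 * q n 3 * q n 2) * q n 1 ^ m := by rw [hb]
    _ = _ := by group

theorem conjTwo_mul_conjTwo {n : ℕ} (hn : 3 ≤ n) (m : ℤ) :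
    conjTwo n m * conjTwo n (m - 1) = q n 2 * q n 1 * q n 2 * q n 1 * q n 1 ^ (-2 : ℤ) := by
  have hc : Commute (q n 1) (q n 2 * q n 1 * q n 2 * q n 1) := by
    have h := q_four_braid hn
    calc q n 1 * (q n 2 * q n 1 * q n 2 * q n 1)
        = q n 1 * q n 2 * q n 1 * q n 2 * q n 1 := by group
      _ = _ := by rw [h]
  calc conjTwo n m * conjTwo n (m - 1)
      = q n 1 ^ (-m) * (q n 2 * q n 1 * q n 2 * q n 1) * q n 1 ^ (m - 2) := by
        rw [conjTwo, conjTwo]; group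
    _ = _ := by rw [(hc.zpow_left _).eq, mul_assoc, ← zpow_add]; congr 2; ring

end ArtinB

namespace BGrp

open ArtinB

/-- The effect of `s̃_j` on the strands left after deleting the one in position `c`. -/
def sWeight (n j c : ℕ) : ArtinB n :=
  if c = 0 ∨ n < c ∨ c = j - 1 ∨ c = j then 1 else if j < c then q n j else q n (j - 1)

/-- The effect of a generator `t̃_i`, with `i` in the `m`-th block of length `k`,
on the strands left after deleting the one in position `c`. -/
def tWeight (n : ℕ) (m : ℤ) (c : ℕ) : ArtinB n :=
  if c = 0 ∨ n < c then 1 else if c = 1 then q n 1 ^ (-m) else if c = 2 then q n 1 ^ m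
  else conjTwo n m

/-- The monomial permutation of `ℕ × ArtinB n` attached to `s̃_j`. -/
def sPerm (n j : ℕ) : Equiv.Perm (ℕ × ArtinB n) :=
  Equiv.prodShear (Equiv.swap (j - 1) j) fun c => Equiv.mulLeft (sWeight n j c)

/-- The monomial permutation of `ℕ × ArtinB n` attached to a generator `t̃_i`
with `i` in the `m`-th block of length `k`. -/
def tPerm (n : ℕ) (m : ℤ) : Equiv.Perm (ℕ × ArtinB n) :=
  Equiv.prodShear (Equiv.swap 1 2) fun c => Equiv.mulLeft (tWeight n m c)

@[simp] theorem sPerm_apply (n j c : ℕ) (x : ArtinB n) :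
    sPerm n j (c, x) = (Equiv.swap (j - 1) j c, sWeight n j c * x) := rfl

@[simp] theorem tPerm_apply (n : ℕ) (m : ℤ) (c : ℕ) (x : ArtinB n) :
    tPerm n m (c, x) = (Equiv.swap 1 2 c, tWeight n m c * x) := rfl

theorem sPerm_comm {n i j : ℕ} (hi : 3 ≤ i) (hj : j ≤ n) (h : i + 1 < j) :
    sPerm n i * sPerm n j = sPerm n j * sPerm n i := by
  ext1 ⟨c, x⟩
  have h1 := (q_comm (n := n) (i := i) (j := j) (by omega)).eq
  have h2 := (q_comm (n := n) (i := i - 1) (j := j) (by omega)).eq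
  have h3 := (q_comm (n := n) (i := i - 1) (j := j - 1) (by omega)).eq
  have h4 : i + 1 < j - 1 → q n i * q n (j - 1) = q n (j - 1) * q n i :=
    fun h => (q_comm (n := n) h).eq
  simp only [Equiv.Perm.mul_apply, sPerm_apply, sWeight, Equiv.swap_apply_def, Prod.mk.injEq,
    ← mul_assoc]
  grind

theorem sPerm_braid {n i : ℕ} (hi : 3 ≤ i) (hin : i + 1 ≤ n) :
    sPerm n i * sPerm n (i + 1) * sPerm n i = sPerm n (i + 1) * sPerm n i * sPerm n (i + 1) := by
  ext1 ⟨c, x⟩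
  have h1 : i + 1 < c → c ≤ n → q n i * q n (i + 1) * q n i = q n (i + 1) * q n i * q n (i + 1) :=
    fun _ _ => q_braid (by omega) (by omega)
  have h2 := q_braid (n := n) (i := i - 1) (by omega) (by omega)
  rw [Nat.sub_add_cancel (by omega)] at h2
  simp only [Equiv.Perm.mul_apply, sPerm_apply, sWeight, Equiv.swap_apply_def, Prod.mk.injEq,
    ← mul_assoc, Nat.add_sub_cancel]
  have hc : c = i - 1 ∨ c = i ∨ c = i + 1 ∨ c < i - 1 ∨ i + 1 < c := by omega
  rcases hc with rfl | rfl | rfl | hc | hc <;> grind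

theorem sPerm_tPerm_comm {n j : ℕ} (m : ℤ) (hj : 4 ≤ j) (hjn : j ≤ n) :
    sPerm n j * tPerm n m = tPerm n m * sPerm n j := by
  ext1 ⟨c, x⟩
  have h1 : ∀ e : ℤ, q n 1 ^ e * q n (j - 1) = q n (j - 1) * q n 1 ^ e :=
    fun e => ((q_comm (by omega)).zpow_left e).eq
  have h2 := (conjTwo_comm (n := n) m hj).eq
  have h3 : 4 ≤ j - 1 → conjTwo n m * q n (j - 1) = q n (j - 1) * conjTwo n m :=
    fun h => (conjTwo_comm m h).eq
  have h4 := h1 m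
  have h5 := h1 (-m)
  simp only [Equiv.Perm.mul_apply, sPerm_apply, tPerm_apply, sWeight, tWeight,
    Equiv.swap_apply_def, Prod.mk.injEq, ← mul_assoc]
  have hc : c = 0 ∨ c = 1 ∨ c = 2 ∨ c = j - 1 ∨ c = j ∨ (2 < c ∧ c < j - 1) ∨ j < c := by omega
  rcases hc with rfl | rfl | rfl | rfl | rfl | hc | hc <;> grind

theorem sPerm_tPerm_braid {n : ℕ} (hn : 3 ≤ n) (m : ℤ) :
    sPerm n 3 * tPerm n m * sPerm n 3 = tPerm n m * sPerm n 3 * tPerm n m := by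
  ext1 ⟨c, x⟩
  have h1 : 4 ≤ n → q n 3 * conjTwo n m * q n 3 = conjTwo n m * q n 3 * conjTwo n m :=
    fun h => conjTwo_braid h m
  have h2 : conjTwo n m * q n 1 ^ (-m) = q n 1 ^ (-m) * q n 2 := by rw [conjTwo]; group
  have h3 : q n 1 ^ m * conjTwo n m = q n 2 * q n 1 ^ m := by rw [conjTwo]; group
  simp only [Equiv.Perm.mul_apply, sPerm_apply, tPerm_apply, sWeight, tWeight,
    Equiv.swap_apply_def, Prod.mk.injEq, ← mul_assoc]
  have hc : c = 0 ∨ c = 1 ∨ c = 2 ∨ c = 3 ∨ (3 < c ∧ c ≤ n) ∨ n < c := by omega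
  rcases hc with rfl | rfl | rfl | rfl | ⟨hc, hcn⟩ | hc
  · grind
  · grind
  · grind [conjTwo]
  · grind
  · simp [h1 (by omega), show c ≠ 0 by omega, show c ≠ 1 by omega, show c ≠ 2 by omega,
      show c ≠ 3 by omega, hc, hcn.not_gt]
  · grind

theorem tPerm_mul_tPerm {n : ℕ} (hn : 3 ≤ n) (m l : ℤ) :
    tPerm n m * tPerm n (m - 1) = tPerm n l * tPerm n (l - 1) := by
  ext1 ⟨c, x⟩
  have h1 := (conjTwo_mul_conjTwo hn m).trans (conjTwo_mul_conjTwo hn l).symm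
  have h2 : ∀ e : ℤ, q n 1 ^ e * q n 1 ^ (-(e - 1)) = q n 1 := fun e => by group
  have h3 : ∀ e : ℤ, q n 1 ^ (-e) * q n 1 ^ (e - 1) = (q n 1)⁻¹ := fun e => by group
  have h4 := (h2 m).trans (h2 l).symm
  have h5 := (h3 m).trans (h3 l).symm
  simp only [Equiv.Perm.mul_apply, tPerm_apply, tWeight, Equiv.swap_apply_def, Prod.mk.injEq,
    ← mul_assoc]
  grind

/-- The permutations assigned to the generators of `BGrp n k`. -/
def genPerm (n : ℕ) (k : ℤ) : Gen n → Equiv.Perm (ℕ × ArtinB n) :=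
  Sum.elim (fun i => tPerm n (i / k)) fun j => sPerm n j.val

theorem lift_genPerm_eq_one {n : ℕ} (hn : 3 ≤ n) {k : ℤ} (hk : k ≠ 0) :
    ∀ r ∈ BRels n k, FreeGroup.lift (genPerm n k) r = 1 := by
  have hdiv : ∀ i : ℤ, (i - k) / k = i / k - 1 := fun i => by
    rw [Int.sub_ediv_of_dvd _ dvd_rfl, Int.ediv_self hk]
  rintro r (⟨i, j, h, rfl⟩ | ⟨i, j, h, rfl⟩ | ⟨i, j, h, rfl⟩ | ⟨i, j, h, rfl⟩ | ⟨i, j, rfl⟩) <;>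
    simp only [gs, gt, map_mul, map_inv, FreeGroup.lift_apply_of, genPerm, Sum.elim_inl,
      Sum.elim_inr, mul_inv_eq_one]
  · rcases h with h | h
    · rw [← h]; exact sPerm_braid i.2.1 (by have := j.2.2; omega)
    · rw [← h]; exact (sPerm_braid j.2.1 (by have := i.2.2; omega)).symm
  · rcases h with h | h
    · exact sPerm_comm i.2.1 j.2.2 h
    · exact (sPerm_comm j.2.1 i.2.2 h).symm
  · rw [h]; exact sPerm_tPerm_braid hn _
  · exact sPerm_tPerm_comm _ h j.2.2
  · rw [hdiv, hdiv]; exact tPerm_mul_tPerm hn _ _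

/-- The monomial action of `BGrp n k` on `ℕ × ArtinB n`, which records the effect of
deleting one strand. -/
def toPerm {n : ℕ} (hn : 3 ≤ n) {k : ℤ} (hk : k ≠ 0) :
    BGrp n k →* Equiv.Perm (ℕ × ArtinB n) :=
  PresentedGroup.toGroup (lift_genPerm_eq_one hn hk)

theorem toPerm_bgt {n : ℕ} (hn : 3 ≤ n) {k : ℤ} (hk : k ≠ 0) (i : ℤ) :
    toPerm hn hk (bgt n k i) = tPerm n (i / k) :=
  PresentedGroup.toGroup.of _

theorem toPerm_bgs {n : ℕ} (hn : 3 ≤ n) {k : ℤ} (hk : k ≠ 0) (j : SIdx n) :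
    toPerm hn hk (bgs n k j) = sPerm n j.val :=
  PresentedGroup.toGroup.of _

theorem bgs_braid {n : ℕ} {k : ℤ} {i j : SIdx n} (h : i.val + 1 = j.val) :
    bgs n k i * bgs n k j * bgs n k i = bgs n k j * bgs n k i * bgs n k j :=
  PresentedGroup.mk_eq_mk_of_mul_inv_mem (Or.inl ⟨i, j, Or.inl h, rfl⟩)

theorem bgs_comm {n : ℕ} {k : ℤ} {i j : SIdx n} (h : i.val + 1 < j.val ∨ j.val + 1 < i.val) :
    Commute (bgs n k i) (bgs n k j) :=
  PresentedGroup.mk_eq_mk_of_mul_inv_mem (Or.inr (Or.inl ⟨i, j, h, rfl⟩))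

theorem bgs_bgt_braid {n : ℕ} {k : ℤ} {j : SIdx n} (h : j.val = 3) (i : ℤ) :
    bgs n k j * bgt n k i * bgs n k j = bgt n k i * bgs n k j * bgt n k i :=
  PresentedGroup.mk_eq_mk_of_mul_inv_mem (Or.inr (Or.inr (Or.inl ⟨i, j, h, rfl⟩)))

theorem bgs_bgt_comm {n : ℕ} {k : ℤ} {j : SIdx n} (h : 4 ≤ j.val) (i : ℤ) :
    Commute (bgs n k j) (bgt n k i) :=
  PresentedGroup.mk_eq_mk_of_mul_inv_mem (Or.inr (Or.inr (Or.inr (Or.inl ⟨i, j, h, rfl⟩))))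

theorem bgt_mul_bgt (n : ℕ) (k i j : ℤ) :
    bgt n k i * bgt n k (i - k) = bgt n k j * bgt n k (j - k) :=
  PresentedGroup.mk_eq_mk_of_mul_inv_mem (Or.inr (Or.inr (Or.inr (Or.inr ⟨i, j, rfl⟩))))

end BGrp

/-- If `s` is braided with `a`, `b`, `c` and `ab = bc`, then `ab` and `s` satisfy the braid
relation of length four. -/
theorem four_braid_of_braid {G : Type*} [Group G] {a b c s : G} (ha : s * a * s = a * s * a)
    (hb : s * b * s = b * s * b) (hc : s * c * s = c * s * c) (h : a * b = b * c) :
    a * b * s * (a * b) * s = s * (a * b) * s * (a * b) := by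
  calc a * b * s * (a * b) * s = a * b * s * (b * c) * s := congrArg (a * b * s * · * s) h
    _ = a * (b * s * b) * c * s := by simp only [mul_assoc]
    _ = a * s * b * (s * c * s) := by rw [← hb]; simp only [mul_assoc]
    _ = a * s * (b * c) * s * c := by rw [hc]; simp only [mul_assoc]
    _ = (a * s * a) * b * s * c := by rw [← h]; simp only [mul_assoc]
    _ = s * a * (s * b * s) * c := by rw [← ha]; simp only [mul_assoc]
    _ = s * (a * b) * s * (b * c) := by rw [hb]; simp only [mul_assoc]
    _ = _ := by rw [← h]

namespace ArtinB

open BGrp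

/-- The images of the generators `q_i` in `BGrp n k`. -/
def genImage (n : ℕ) (k : ℤ) (i : QIdx n) : BGrp n k :=
  if h : 2 ≤ i.val then bgs n k ⟨i.val + 1, by have := i.2.2; omega⟩
  else bgt n k k * bgt n k 0

theorem genImage_one {n : ℕ} {k : ℤ} {i : QIdx n} (h : i.val = 1) :
    genImage n k i = bgt n k k * bgt n k 0 := dif_neg (by omega)

theorem genImage_of_two_le {n : ℕ} {k : ℤ} {i : QIdx n} (h : 2 ≤ i.val) :
    genImage n k i = bgs n k ⟨i.val + 1, by have := i.2.2; omega⟩ := dif_pos h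

theorem genImage_comm {n : ℕ} {k : ℤ} {i j : QIdx n} (h : i.val + 1 < j.val) :
    Commute (genImage n k i) (genImage n k j) := by
  have hi := i.2.1
  rw [genImage_of_two_le (i := j) (by omega)]
  rcases hi.eq_or_lt with h1 | h1
  · rw [genImage_one h1.symm]
    exact ((bgs_bgt_comm (by simp only; omega) _).mul_right
      (bgs_bgt_comm (by simp only; omega) _)).symm
  · rw [genImage_of_two_le h1]
    exact bgs_comm (Or.inl (by simp only; omega))

theorem lift_genImage_eq_one (n : ℕ) (k : ℤ) :
    ∀ r ∈ ArtinBRels n, FreeGroup.lift (genImage n k) r = 1 := by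
  rintro r (⟨i, j, hi, hj, rfl⟩ | ⟨i, j, hi, hj, rfl⟩ | ⟨i, j, h, rfl⟩) <;>
    simp only [gq, map_mul, map_inv, FreeGroup.lift_apply_of, mul_inv_eq_one]
  · rw [genImage_one hi, genImage_of_two_le hj.ge]
    refine four_braid_of_braid (c := bgt n k (0 - k)) ?_ ?_ ?_ ?_
    iterate 3 exact bgs_bgt_braid (by simp only; omega) _
    simpa using bgt_mul_bgt n k k 0
  · rw [genImage_of_two_le hi, genImage_of_two_le (by omega)]
    exact bgs_braid (by simp only; omega)
  · exact h.elim (fun h => (genImage_comm h).eq) fun h => (genImage_comm h).symm.eq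

/-- The homomorphism `q_1 ↦ t̃_k t̃_0`, `q_{j-1} ↦ s̃_j`. -/
def toBGrp (n : ℕ) (k : ℤ) : ArtinB n →* BGrp n k :=
  PresentedGroup.toGroup (lift_genImage_eq_one n k)

theorem toBGrp_of {n : ℕ} {k : ℤ} (i : QIdx n) :
    toBGrp n k (PresentedGroup.of i) = genImage n k i :=
  PresentedGroup.toGroup.of _

theorem toPerm_toBGrp {n : ℕ} (hn : 3 ≤ n) {k : ℤ} (hk : k ≠ 0) (b x : ArtinB n) :
    toPerm hn hk (toBGrp n k b) (1, x) = (1, b * x) := by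
  have hb : b ∈ Subgroup.closure (Set.range PresentedGroup.of) := by
    rw [PresentedGroup.closure_range_of]; trivial
  induction hb using Subgroup.closure_induction generalizing x with
  | mem _ h =>
    obtain ⟨i, rfl⟩ := h
    rw [toBGrp_of, ← q_of_mem i.2]
    rcases i.2.1.eq_or_lt with h | h
    · rw [genImage_one h.symm, map_mul, toPerm_bgt, toPerm_bgt, Int.ediv_self hk, Int.zero_ediv,
        ← h]
      simp [tWeight, show ¬ n < 1 by omega, show ¬ n < 2 by omega]
    · rw [genImage_of_two_le h, toPerm_bgs]
      have hi := i.2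
      simp only [sPerm_apply, sWeight, Equiv.swap_apply_def, Nat.add_sub_cancel]
      grind
  | one => simp
  | mul a b _ _ ha hb => rw [map_mul, map_mul, Equiv.Perm.mul_apply, hb, ha, mul_assoc]
  | inv a _ ha => rw [map_inv, map_inv, Equiv.Perm.inv_eq_iff_eq, ha, mul_inv_cancel_left]

theorem toBGrp_injective {n : ℕ} (hn : 3 ≤ n) {k : ℤ} (hk : k ≠ 0) :
    Function.Injective (toBGrp n k) := fun a b h => by
  have := (toPerm_toBGrp hn hk a 1).symm.trans (h ▸ toPerm_toBGrp hn hk b 1)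
  simpa using this

end ArtinB

/-- the Artin group `B(B_{n-1})` embeds into `B^{(k)}(∞,∞,n)` by
`q_1 ↦ t̃_k t̃_0` and `q_{j-1} ↦ s̃_j` for `3 ≤ j ≤ n`. -/
theorem stmt_15 (n : ℕ) (hn : 3 ≤ n) (k : ℤ) (hk : k ≠ 0) :
    ∃ f : ArtinB n →* BGrp n k,
      Function.Injective f ∧
      (∀ i : QIdx n, i.val = 1 →
        f (PresentedGroup.of i) = bgt n k k * bgt n k 0) ∧
      ∀ (i : QIdx n) (h : 2 ≤ i.val),
        f (PresentedGroup.of i) =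
          bgs n k ⟨i.val + 1, by obtain ⟨h1, h2⟩ := i.2; omega⟩ := by
  exact ⟨ArtinB.toBGrp n k, ArtinB.toBGrp_injective hn hk,
    fun i h => (ArtinB.toBGrp_of i).trans (ArtinB.genImage_one h),
    fun i h => (ArtinB.toBGrp_of i).trans (ArtinB.genImage_of_two_le h)⟩
end

section
/- For every n ≥ 2 and every nonzero integer k, the group B^{(k)}(∞,∞,n) is torsion-free: every element of finite order is the identity. -/
/-- A complement on a set of letters: each pair of letters `a`, `b` is assigned a word `compl a b`,
giving rise to the relation `a * compl a b = b * compl b a`. -/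
structure WordComplement (S : Type*) where
  /-- The word by which `a` has to be multiplied to reach the common multiple with `b`. -/
  compl : S → S → FreeMonoid S
  compl_self : ∀ a, compl a a = 1
  length_compl : ∀ a b, (compl a b).length = (compl b a).length

namespace WordComplement

variable {S : Type*} (κ : WordComplement S)

/-- The relations `a * compl a b = b * compl b a`. -/
def Rel (x y : FreeMonoid S) : Prop :=
  ∃ a b, x = FreeMonoid.of a * κ.compl a b ∧ y = FreeMonoid.of b * κ.compl b a

/-- The monoid presented by a complement. -/
abbrev Mon := PresentedMonoid κ.Rel

/-- A letter, as an element of the presented monoid. -/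
def gen (a : S) : κ.Mon := PresentedMonoid.of κ.Rel a

/-- The value of `compl a b` in the presented monoid. -/
def res (a b : S) : κ.Mon := PresentedMonoid.mk κ.Rel (κ.compl a b)

theorem gen_mul_res (a b : S) : κ.gen a * κ.res a b = κ.gen b * κ.res b a := by
  have := PresentedMonoid.mk_eq_mk_of_rel (rels := κ.Rel) ⟨a, b, rfl, rfl⟩
  rwa [map_mul, map_mul] at this

@[simp] theorem res_self (a : S) : κ.res a a = 1 := by
  simp [res, κ.compl_self]

theorem lift_ofAdd_one (x : FreeMonoid S) :
    FreeMonoid.lift (fun _ : S => Multiplicative.ofAdd 1) x = Multiplicative.ofAdd x.length := by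
  induction x using FreeMonoid.inductionOn' with
  | one => simp
  | of_mul a x ih => simp [ih, ofAdd_add]

/-- The length homomorphism. -/
def lenHom : κ.Mon →* Multiplicative ℕ :=
  PresentedMonoid.lift (fun _ => Multiplicative.ofAdd 1) (by
    rintro _ _ ⟨a, b, rfl, rfl⟩
    simp [lift_ofAdd_one, κ.length_compl a b])

/-- The length of an element of the presented monoid. -/
def len (x : κ.Mon) : ℕ := (κ.lenHom x).toAdd

@[simp] theorem len_one : κ.len 1 = 0 := by simp [len]

@[simp] theorem len_mul (x y : κ.Mon) : κ.len (x * y) = κ.len x + κ.len y := by simp [len]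

@[simp] theorem len_gen (a : S) : κ.len (κ.gen a) = 1 := rfl

@[simp] theorem len_mk (x : FreeMonoid S) : κ.len (PresentedMonoid.mk κ.Rel x) = x.length := by
  change (FreeMonoid.lift (fun _ : S => Multiplicative.ofAdd 1) x).toAdd = _
  rw [lift_ofAdd_one]; rfl

@[elab_as_elim]
theorem gen_induction {p : κ.Mon → Prop} (x : κ.Mon) (one : p 1)
    (gen_mul : ∀ a x, p x → p (κ.gen a * x)) : p x := by
  obtain ⟨x, rfl⟩ := PresentedMonoid.surjective_mk x
  induction x using FreeMonoid.inductionOn' with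
  | one => exact one
  | of_mul a x ih => rw [map_mul]; exact gen_mul a _ ih

theorem eq_one_of_len_eq_zero {x : κ.Mon} (h : κ.len x = 0) : x = 1 := by
  induction x using κ.gen_induction with
  | one => rfl
  | gen_mul a x ih => simp at h

theorem eq_one_or_gen_mul (x : κ.Mon) : x = 1 ∨ ∃ a y, x = κ.gen a * y := by
  induction x using κ.gen_induction with
  | one => exact Or.inl rfl
  | gen_mul a x ih => exact Or.inr ⟨a, x, rfl⟩

/-- Equalities `a * u = b * v` with `u` shorter than `N` come from multiples of
`a * res a b = b * res b a`. -/
def RedUpTo (N : ℕ) : Prop :=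
  ∀ a b u v, κ.len u < N → κ.gen a * u = κ.gen b * v →
    ∃ w, u = κ.res a b * w ∧ v = κ.res b a * w

/-- The cube condition, relative to reductions of bounded length. -/
def Cube : Prop :=
  ∀ N, κ.RedUpTo N → ∀ a b c w w', κ.len (κ.res c a * w) ≤ N →
    κ.res c a * w = κ.res c b * w' →
      ∃ z, κ.res a c * w = κ.res a b * z ∧ κ.res b c * w' = κ.res b a * z

/-- Two words are compatible if both are empty, or if they reduce as in `RedUpTo`. -/
def Compat (x y : FreeMonoid S) : Prop :=
  (x = 1 ∧ y = 1) ∨ ∃ a b x' y' w, x = FreeMonoid.of a * x' ∧ y = FreeMonoid.of b * y' ∧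
    PresentedMonoid.mk κ.Rel x' = κ.res a b * w ∧ PresentedMonoid.mk κ.Rel y' = κ.res b a * w

variable {κ}

theorem Compat.symm {x y : FreeMonoid S} (h : κ.Compat x y) : κ.Compat y x := by
  rcases h with ⟨rfl, rfl⟩ | ⟨a, b, x', y', w, hx, hy, hx', hy'⟩
  · exact Or.inl ⟨rfl, rfl⟩
  · exact Or.inr ⟨b, a, y', x', w, hy, hx, hy', hx'⟩

theorem Compat.refl (x : FreeMonoid S) : κ.Compat x x := by
  induction x using FreeMonoid.casesOn with
  | one => exact Or.inl ⟨rfl, rfl⟩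
  | of_mul a x => exact Or.inr ⟨a, a, x, x, PresentedMonoid.mk κ.Rel x, rfl, rfl, by simp, by simp⟩

theorem RedUpTo.compat (hC : κ.Cube) {N : ℕ} (hR : κ.RedUpTo N) {x y : FreeMonoid S}
    (h : ConGen.Rel κ.Rel x y) (hN : x.length ≤ N + 1) : κ.Compat x y := by
  have hlen : ∀ {x y}, ConGen.Rel κ.Rel x y → x.length = y.length := by
    intro x y h
    have := congrArg κ.len (PresentedMonoid.mk_eq_mk_iff.2 h)
    simpa using this
  induction h with
  | of x y h =>
    obtain ⟨a, b, rfl, rfl⟩ := h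
    exact Or.inr ⟨a, b, _, _, 1, rfl, rfl, by simp [res], by simp [res]⟩
  | refl x => exact Compat.refl x
  | symm h ih => exact (ih (by rwa [hlen h])).symm
  | trans h₁ h₂ ih₁ ih₂ =>
    rcases ih₁ hN with ⟨rfl, rfl⟩ | ⟨a, c, x', y', w, rfl, hy, hx', hy'⟩
    · exact ih₂ (by simp)
    · rcases ih₂ (hlen h₁ ▸ hN) with ⟨rfl, rfl⟩ | ⟨c', b, y'', z', w', hy₂, rfl, hy₂', hz'⟩
      · exact absurd hy (by
          intro h
          have := congrArg FreeMonoid.length h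
          simp only [FreeMonoid.length_one, FreeMonoid.length_mul, FreeMonoid.length_of] at this
          omega)
      · obtain ⟨rfl, rfl⟩ : c = c' ∧ y' = y'' := by
          have : c :: y'.toList = c' :: y''.toList := hy.symm.trans hy₂
          simpa using this
        have hl := hlen h₁
        rw [hy] at hl
        simp only [FreeMonoid.length_mul, FreeMonoid.length_of] at hl hN
        obtain ⟨z, hz₁, hz₂⟩ := hC N hR a b c w w'
          (by rw [← hy', len_mk]; omega) (hy'.symm.trans hy₂')
        exact Or.inr ⟨a, b, x', z', z, rfl, rfl, hx'.trans hz₁, hz'.trans hz₂⟩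
  | @mul x₁ x₂ y₁ y₂ h₁ h₂ ih₁ ih₂ =>
    simp only [FreeMonoid.length_mul] at hN
    rcases ih₁ (by omega) with ⟨rfl, rfl⟩ | ⟨a, b, x', y', w, rfl, rfl, hx', hy'⟩
    · simpa using ih₂ (by omega)
    · refine Or.inr ⟨a, b, x' * y₁, y' * y₂, w * PresentedMonoid.mk κ.Rel y₁,
        mul_assoc _ _ _, mul_assoc _ _ _, ?_, ?_⟩
      · rw [map_mul, hx', mul_assoc]
      · rw [map_mul, hy', mul_assoc, PresentedMonoid.mk_eq_mk_iff.2 h₂]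

theorem Cube.redUpTo (hC : κ.Cube) (N : ℕ) : κ.RedUpTo N := by
  induction N with
  | zero => intro a b u v h; simp at h
  | succ N hR =>
    intro a b u v hu h
    obtain ⟨u, rfl⟩ := PresentedMonoid.surjective_mk u
    obtain ⟨v, rfl⟩ := PresentedMonoid.surjective_mk v
    simp only [gen, PresentedMonoid.of, ← map_mul] at h
    rw [len_mk] at hu
    rcases hR.compat hC (PresentedMonoid.mk_eq_mk_iff.1 h)
        (by simp only [FreeMonoid.length_mul, FreeMonoid.length_of]; omega) with
      ⟨h₁, -⟩ | ⟨a', b', u', v', w, h₁, h₂, hu', hv'⟩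
    · have := congrArg FreeMonoid.length h₁
      simp at this
    · obtain ⟨rfl, rfl⟩ : a = a' ∧ u = u' := by
        have : a :: u.toList = a' :: u'.toList := h₁
        simpa using this
      obtain ⟨rfl, rfl⟩ : b = b' ∧ v = v' := by
        have : b :: v.toList = b' :: v'.toList := h₂
        simpa using this
      exact ⟨w, hu', hv'⟩

theorem Cube.red (hC : κ.Cube) {a b : S} {u v : κ.Mon} (h : κ.gen a * u = κ.gen b * v) :
    ∃ w, u = κ.res a b * w ∧ v = κ.res b a * w :=
  hC.redUpTo (κ.len u + 1) a b u v (by omega) h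

theorem RedUpTo.cancel {N : ℕ} (hR : κ.RedUpTo N) {a : S} {u v : κ.Mon} (hu : κ.len u < N)
    (h : κ.gen a * u = κ.gen a * v) : u = v := by
  obtain ⟨w, rfl, rfl⟩ := hR a a u v hu h
  rfl

theorem Cube.mul_left_cancel (hC : κ.Cube) (x : κ.Mon) {u v : κ.Mon} (h : x * u = x * v) :
    u = v := by
  induction x using κ.gen_induction with
  | one => simpa using h
  | gen_mul a x ih =>
    rw [mul_assoc, mul_assoc] at h
    exact ih ((hC.redUpTo _).cancel (Nat.lt_succ_self _) h)

theorem Cube.mul_dvd_mul_iff_left (hC : κ.Cube) (x : κ.Mon) {u v : κ.Mon} :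
    x * u ∣ x * v ↔ u ∣ v := by
  constructor
  · rintro ⟨w, hw⟩
    exact ⟨w, hC.mul_left_cancel x (by rw [hw, mul_assoc])⟩
  · rintro ⟨w, rfl⟩
    exact ⟨w, by rw [mul_assoc]⟩

/-- Elements with a common right multiple have a least common right multiple. -/
theorem Cube.exists_lcm (hC : κ.Cube) {x y m : κ.Mon} (hx : x ∣ m) (hy : y ∣ m) :
    ∃ l, ∀ z, l ∣ z ↔ x ∣ z ∧ y ∣ z := by
  induction h : κ.len m using Nat.strong_induction_on generalizing x y m with
  | _ N ih
  subst h
  rcases κ.eq_one_or_gen_mul x with rfl | ⟨a, x, rfl⟩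
  · exact ⟨y, fun z => by simp⟩
  rcases κ.eq_one_or_gen_mul y with rfl | ⟨b, y, rfl⟩
  · exact ⟨κ.gen a * x, fun z => by simp⟩
  obtain ⟨u, hu⟩ := hx
  obtain ⟨v, hv⟩ := hy
  rw [mul_assoc] at hu hv
  obtain ⟨w, hw₁, hw₂⟩ := hC.red (hu.symm.trans hv)
  have hlu := congrArg κ.len hu
  have hlv := congrArg κ.len hv
  have hlw := congrArg κ.len hw₁
  rw [len_mul κ (κ.gen a), len_gen] at hlu
  rw [len_mul κ (κ.gen b), len_gen] at hlv
  rw [len_mul κ (κ.res a b)] at hlw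
  obtain ⟨l₁, hl₁⟩ := ih _ (by omega) (Dvd.intro u rfl) (Dvd.intro w hw₁.symm) rfl
  obtain ⟨l₂, hl₂⟩ := ih _ (by omega) (Dvd.intro v rfl) (Dvd.intro w hw₂.symm) rfl
  obtain ⟨p, rfl⟩ := ((hl₁ l₁).1 dvd_rfl).2
  obtain ⟨q, rfl⟩ := ((hl₂ l₂).1 dvd_rfl).2
  have hp : p ∣ w := (hC.mul_dvd_mul_iff_left _).1
    ((hl₁ _).2 ⟨Dvd.intro u hw₁, dvd_mul_right _ _⟩)
  have hq : q ∣ w := (hC.mul_dvd_mul_iff_left _).1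
    ((hl₂ _).2 ⟨Dvd.intro v hw₂, dvd_mul_right _ _⟩)
  obtain ⟨r, hr⟩ := ih _ (by omega) hp hq rfl
  refine ⟨κ.gen a * (κ.res a b * r), fun z => ⟨fun hz => ⟨?_, ?_⟩, ?_⟩⟩
  · refine dvd_trans ((hC.mul_dvd_mul_iff_left _).2 (dvd_trans ((hl₁ _).1 dvd_rfl).1 ?_)) hz
    exact (hC.mul_dvd_mul_iff_left _).2 ((hr r).1 dvd_rfl).1
  · refine dvd_trans ?_ hz
    rw [← mul_assoc, gen_mul_res, mul_assoc]
    refine (hC.mul_dvd_mul_iff_left _).2 (dvd_trans ((hl₂ _).1 dvd_rfl).1 ?_)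
    exact (hC.mul_dvd_mul_iff_left _).2 ((hr r).1 dvd_rfl).2
  · rintro ⟨⟨s, rfl⟩, ⟨t, ht⟩⟩
    rw [mul_assoc, mul_assoc] at ht
    obtain ⟨w', hw₁', hw₂'⟩ := hC.red ht
    rw [mul_assoc, hw₁']
    refine (hC.mul_dvd_mul_iff_left _).2 ((hC.mul_dvd_mul_iff_left _).2 ((hr w').2 ⟨?_, ?_⟩))
    · exact (hC.mul_dvd_mul_iff_left _).1 ((hl₁ _).2 ⟨Dvd.intro s hw₁', dvd_mul_right _ _⟩)
    · exact (hC.mul_dvd_mul_iff_left _).1 ((hl₂ _).2 ⟨Dvd.intro t hw₂', dvd_mul_right _ _⟩)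

theorem eq_one_of_pow_eq_one {z : κ.Mon} {m : ℕ} (hm : m ≠ 0) (h : z ^ m = 1) : z = 1 := by
  apply eq_one_of_len_eq_zero
  have := congrArg κ.len h
  simpa [len, hm] using this

/-- If every letter left-divides `δ` and can be moved across `δ`, then any two elements have a
common right multiple. -/
theorem exists_mul_eq_mul (δ : κ.Mon) (hdvd : ∀ a, κ.gen a ∣ δ)
    (hcomm : ∀ a, δ ∣ κ.gen a * δ) (x y : κ.Mon) : ∃ p q, x * p = y * q := by
  have hδ : ∀ x, δ ∣ x * δ := by
    intro x
    induction x using κ.gen_induction with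
    | one => simp
    | gen_mul a x ih =>
      obtain ⟨p, hp⟩ := ih
      obtain ⟨q, hq⟩ := hcomm a
      exact ⟨q * p, by rw [mul_assoc, hp, ← mul_assoc, hq, mul_assoc]⟩
  have hpow : ∀ (n : ℕ) (x : κ.Mon), δ ^ n ∣ x * δ ^ n := by
    intro n
    induction n with
    | zero => simp
    | succ n ih =>
      intro x
      obtain ⟨p, hp⟩ := ih x
      obtain ⟨q, hq⟩ := hδ p
      exact ⟨q, by rw [pow_succ, ← mul_assoc, hp, mul_assoc, hq, mul_assoc]⟩
  have hlen : ∀ x, x ∣ δ ^ κ.len x := by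
    intro x
    induction x using κ.gen_induction with
    | one => simp
    | gen_mul a x ih =>
      obtain ⟨d, hd⟩ := hdvd a
      obtain ⟨p, hp⟩ := ih
      obtain ⟨q, hq⟩ := hpow (κ.len x) d
      refine ⟨p * q, ?_⟩
      rw [len_mul, len_gen, add_comm, pow_succ', hd, mul_assoc, ← hd, hq, hp]
      simp only [mul_assoc]
  obtain ⟨p, hp⟩ := dvd_trans (hlen x) (pow_dvd_pow δ (Nat.le_add_right _ (κ.len y)))
  obtain ⟨q, hq⟩ := dvd_trans (hlen y) (pow_dvd_pow δ (Nat.le_add_left _ (κ.len x)))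
  exact ⟨p, q, hp.symm.trans hq⟩

end WordComplement

section Fractions

universe u

variable {M : Type u} {B : Type*} [Monoid M] [Group B]

/-- In a group of left fractions of a monoid with least common right multiples and without torsion,
every element of finite order is trivial. -/
theorem eq_one_of_pow_eq_one_of_fractions (f : M →* B) (hinj : Function.Injective f)
    (hfrac : ∀ g : B, ∃ d a, f d * g = f a) (hleft : ∀ x y : M, ∃ p q, p * x = q * y)
    (hlcm : ∀ x y : M, ∃ l, ∀ z, l ∣ z ↔ x ∣ z ∧ y ∣ z)
    (htf : ∀ (z : M) (m : ℕ), m ≠ 0 → z ^ m = 1 → z = 1)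
    {g : B} {m : ℕ} (hm : m ≠ 0) (h : g ^ m = 1) : g = 1 := by
  have hden : ∀ n : ℕ, ∃ d, ∀ i < n, ∃ a, f d * g ^ i = f a := by
    intro n
    induction n with
    | zero => exact ⟨1, by simp⟩
    | succ n ih =>
      obtain ⟨d, hd⟩ := ih
      obtain ⟨e, b, he⟩ := hfrac (g ^ n)
      obtain ⟨p, q, hpq⟩ := hleft d e
      refine ⟨p * d, fun i hi => ?_⟩
      rcases Nat.lt_succ_iff_lt_or_eq.1 hi with hi | rfl
      · obtain ⟨a, ha⟩ := hd i hi
        exact ⟨p * a, by rw [map_mul, mul_assoc, ha, map_mul]⟩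
      · exact ⟨q * b, by rw [hpq, map_mul, mul_assoc, he, map_mul]⟩
  obtain ⟨d, hd⟩ := hden m
  have hd' : ∀ i, ∃ a, f d * g ^ i = f a := by
    intro i
    obtain ⟨a, ha⟩ := hd (i % m) (Nat.mod_lt _ (Nat.pos_of_ne_zero hm))
    exact ⟨a, by rw [← ha, pow_eq_pow_mod i h]⟩
  choose a ha using hd'
  have hsup : ∀ n : ℕ, ∃ l, ∀ z, l ∣ z ↔ ∀ i < n, a i ∣ z := by
    intro n
    induction n with
    | zero => exact ⟨1, by simp⟩
    | succ n ih =>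
      obtain ⟨l, hl⟩ := ih
      obtain ⟨l', hl'⟩ := hlcm l (a n)
      refine ⟨l', fun z => ?_⟩
      rw [hl', hl, Nat.forall_lt_succ_right]
  obtain ⟨l, hl⟩ := hsup m
  have hal : ∀ i, ∃ z, l = a i * z := by
    intro i
    have : a i = a (i % m) := hinj (by rw [← ha, ← ha, pow_eq_pow_mod i h])
    rw [this]
    exact (hl l).1 dvd_rfl _ (Nat.mod_lt _ (Nat.pos_of_ne_zero hm))
  choose c hc using hal
  have hgl : ∀ i, f d * g * (f d)⁻¹ * f l = f (a (i + 1) * c i) := by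
    intro i
    rw [hc i, map_mul, map_mul, ← ha, ← ha, pow_succ']
    group
  have hdvd : l ∣ a 1 * c 0 := by
    rw [hl]
    intro i _
    refine ⟨c (i + m - 1), hinj ?_⟩
    have e : i + m - 1 + 1 = i + m := by omega
    have : a i = a (i + m - 1 + 1) := hinj (by rw [← ha, ← ha, e, pow_add, h, mul_one])
    rw [this, ← hgl]
    exact hgl (i + m - 1)
  obtain ⟨z, hz⟩ := hdvd
  have hconj : f z = ((f d)⁻¹ * f l)⁻¹ * g * ((f d)⁻¹ * f l) := by
    have := hgl 0
    rw [zero_add, hz, map_mul] at this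
    rw [mul_inv_rev, inv_inv, mul_assoc, mul_assoc, eq_inv_mul_iff_mul_eq, ← this]
    group
  have hz1 : z = 1 := by
    refine htf z m hm (hinj ?_)
    have := conj_pow (i := m) (a := ((f d)⁻¹ * f l)⁻¹) (b := g)
    rw [inv_inv] at this
    rw [map_pow, hconj, this, h]
    simp
  rw [hz1, map_one] at hconj
  have := conj_eq_one_iff (a := ((f d)⁻¹ * f l)⁻¹) (b := g)
  rw [inv_inv] at this
  exact this.1 hconj.symm

open OreLocalization in
/-- A cancellative monoid with common left multiples embeds into the units of a monoid. -/
theorem exists_injective_units [IsCancelMul M] (hleft : ∀ x y : M, ∃ p q, p * x = q * y) :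
    ∃ (Q : Type u) (_ : Monoid Q) (φ : M →* Qˣ), Function.Injective φ := by
  choose p q hpq using hleft
  let _ : OreSet (⊤ : Submonoid M) :=
    { ore_right_cancel := fun r₁ r₂ s h => ⟨1, by rw [mul_right_cancel h]⟩
      oreNum := fun r s => q r s
      oreDenom := fun r s => ⟨p r s, trivial⟩
      ore_eq := fun r s => hpq r s }
  refine ⟨OreLocalization (⊤ : Submonoid M) M, inferInstance,
    Units.liftRight (numeratorHom (S := (⊤ : Submonoid M)))
      (fun x => numeratorUnit (⟨x, trivial⟩ : (⊤ : Submonoid M))) (fun _ => rfl), ?_⟩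
  intro x y hxy
  have h : (x /ₒ (1 : (⊤ : Submonoid M)) : OreLocalization (⊤ : Submonoid M) M) = y /ₒ 1 :=
    congrArg Units.val hxy
  rw [oreDiv_eq_iff] at h
  obtain ⟨u, v, h₁, h₂⟩ := h
  simp only [OneMemClass.coe_one, mul_one] at h₂
  rw [Submonoid.smul_def, smul_eq_mul, smul_eq_mul, h₂] at h₁
  exact (mul_left_cancel h₁).symm

end Fractions

namespace BMonoid

variable {n : ℕ} {k : ℤ}

/-- Pairs of letters subject to a braid relation of length three. -/
def Adj : Gen n → Gen n → Prop
  | .inl _, .inl _ => False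
  | .inl _, .inr s => s.val = 3
  | .inr s, .inl _ => s.val = 3
  | .inr s, .inr s' => s.val + 1 = s'.val ∨ s'.val + 1 = s.val

/-- Pairs of letters subject to a commutation relation. -/
def Far : Gen n → Gen n → Prop
  | .inl _, .inl _ => False
  | .inl _, .inr s => 4 ≤ s.val
  | .inr s, .inl _ => 4 ≤ s.val
  | .inr s, .inr s' => s.val + 1 < s'.val ∨ s'.val + 1 < s.val

theorem Adj.symm {a b : Gen n} (h : Adj a b) : Adj b a := by
  rcases a with i | s <;> rcases b with j | s' <;> simp only [Adj] at * <;> omega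

theorem Far.symm {a b : Gen n} (h : Far a b) : Far b a := by
  rcases a with i | s <;> rcases b with j | s' <;> simp only [Far] at * <;> omega

theorem Adj.ne {a b : Gen n} (h : Adj a b) : a ≠ b := by
  rintro rfl
  rcases a with i | s
  all_goals simp [Adj] at h

theorem Far.ne {a b : Gen n} (h : Far a b) : a ≠ b := by
  rintro rfl
  rcases a with i | s
  all_goals
    simp only [Far] at h
    try omega

theorem Far.not_adj {a b : Gen n} (h : Far a b) : ¬ Adj a b := by
  rcases a with i | s <;> rcases b with j | s' <;> simp only [Adj, Far] at * <;> omega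

theorem not_adj_of_adj_of_adj {a b c : Gen n} (h₁ : Adj c a) (h₂ : Adj c b) : ¬ Adj a b := by
  intro h₃
  rcases a with i | s <;> rcases b with j | s' <;> rcases c with l | s'' <;>
    simp only [Adj] at * <;> omega

/-- Two letters are equal, adjacent, far from each other, or distinct of the form `t̃_i`, `t̃_j`. -/
theorem letters_cases (a b : Gen n) :
    a = b ∨ Adj a b ∨ Far a b ∨ ∃ i j, a = .inl i ∧ b = .inl j ∧ i ≠ j := by
  rcases a with i | ⟨s, hs⟩ <;> rcases b with j | ⟨s', hs'⟩
  all_goals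
    simp only [Adj, Far, Sum.inl.injEq, Sum.inr.injEq, Subtype.mk.injEq]
    grind

open Classical in
/-- The complement word for two letters. -/
noncomputable def word (k : ℤ) (a b : Gen n) : FreeMonoid (Gen n) :=
  if a = b then 1 else if Adj a b then FreeMonoid.of b * FreeMonoid.of a
  else Sum.elim (fun i => Sum.elim (fun _ => FreeMonoid.of (Sum.inl (i - k)))
    (fun s => FreeMonoid.of (Sum.inr s)) b) (fun _ => FreeMonoid.of b) a

theorem word_adj {a b : Gen n} (h : Adj a b) :
    word k a b = FreeMonoid.of b * FreeMonoid.of a := by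
  rw [word, if_neg h.ne, if_pos h]

theorem word_far {a b : Gen n} (h : Far a b) : word k a b = FreeMonoid.of b := by
  rw [word, if_neg h.ne, if_neg h.not_adj]
  rcases a with i | s <;> rcases b with j | s'
  · exact h.elim
  all_goals rfl

theorem word_inl {i j : ℤ} (h : i ≠ j) :
    word k (.inl i : Gen n) (.inl j) = FreeMonoid.of (.inl (i - k)) := by
  rw [word, if_neg (by simpa using h), if_neg (by simp [Adj])]
  rfl

variable (n k) in
/-- The complement defining the positive monoid of `B^{(k)}(∞,∞,n)`. -/
noncomputable def complement : WordComplement (Gen n) where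
  compl := word k
  compl_self a := by simp [word]
  length_compl a b := by
    rcases letters_cases a b with rfl | h | h | ⟨i, j, rfl, rfl, h⟩
    · rfl
    · rw [word_adj h, word_adj h.symm]; simp
    · rw [word_far h, word_far h.symm]; simp
    · rw [word_inl h, word_inl h.symm]; simp

local notation "κ" => complement n k
local notation "γ" => WordComplement.gen (complement n k)
local notation "ρ" => WordComplement.res (complement n k)

theorem res_adj {a b : Gen n} (h : Adj a b) : ρ a b = γ b * γ a := by
  change PresentedMonoid.mk (κ).Rel (word k a b) = _
  rw [word_adj h, map_mul]; rfl

theorem res_far {a b : Gen n} (h : Far a b) : ρ a b = γ b := by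
  change PresentedMonoid.mk (κ).Rel (word k a b) = _
  rw [word_far h]; rfl

theorem res_inl {i j : ℤ} (h : i ≠ j) : ρ (.inl i) (.inl j) = γ (.inl (i - k)) := by
  change PresentedMonoid.mk (κ).Rel (word k (.inl i) (.inl j)) = _
  rw [word_inl h]; rfl

theorem braid {a b : Gen n} (h : Adj a b) (z : (κ).Mon) :
    γ a * (γ b * (γ a * z)) = γ b * (γ a * (γ b * z)) := by
  have := (κ).gen_mul_res a b
  rw [res_adj h, res_adj h.symm] at this
  simpa only [mul_assoc] using congrArg (· * z) this

theorem comm {a b : Gen n} (h : Far a b) (z : (κ).Mon) : γ a * (γ b * z) = γ b * (γ a * z) := by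
  have := (κ).gen_mul_res a b
  rw [res_far h, res_far h.symm] at this
  simpa only [mul_assoc] using congrArg (· * z) this

theorem shift (i j : ℤ) (z : (κ).Mon) :
    γ (.inl i) * (γ (.inl (i - k)) * z) = γ (.inl j) * (γ (.inl (j - k)) * z) := by
  rcases eq_or_ne i j with rfl | h
  · rfl
  have := (κ).gen_mul_res (.inl i) (.inl j)
  rw [res_inl h, res_inl h.symm] at this
  simpa only [mul_assoc] using congrArg (· * z) this

section Reduction

variable {N : ℕ} (hR : (complement n k).RedUpTo N)
include hR

theorem red_adj {a b : Gen n} (h : Adj a b) {u v : (κ).Mon} (e : γ a * u = γ b * v)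
    (hN : (κ).len (γ a * u) ≤ N) : ∃ w, u = γ b * (γ a * w) ∧ v = γ a * (γ b * w) := by
  rw [WordComplement.len_mul, WordComplement.len_gen] at hN
  obtain ⟨w, rfl, rfl⟩ := hR a b u v (by omega) e
  exact ⟨w, by rw [res_adj h, mul_assoc], by rw [res_adj h.symm, mul_assoc]⟩

theorem red_far {a b : Gen n} (h : Far a b) {u v : (κ).Mon} (e : γ a * u = γ b * v)
    (hN : (κ).len (γ a * u) ≤ N) : ∃ w, u = γ b * w ∧ v = γ a * w := by
  rw [WordComplement.len_mul, WordComplement.len_gen] at hN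
  obtain ⟨w, rfl, rfl⟩ := hR a b u v (by omega) e
  exact ⟨w, by rw [res_far h], by rw [res_far h.symm]⟩

theorem red_inl {i j : ℤ} (h : i ≠ j) {u v : (κ).Mon} (e : γ (.inl i) * u = γ (.inl j) * v)
    (hN : (κ).len (γ (.inl i) * u) ≤ N) :
    ∃ w, u = γ (.inl (i - k)) * w ∧ v = γ (.inl (j - k)) * w := by
  rw [WordComplement.len_mul, WordComplement.len_gen] at hN
  obtain ⟨w, rfl, rfl⟩ := hR _ _ u v (by omega) e
  exact ⟨w, by rw [res_inl h], by rw [res_inl h.symm]⟩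

theorem cancel {a : Gen n} {u v : (κ).Mon} (e : γ a * u = γ a * v)
    (hN : (κ).len (γ a * u) ≤ N) : u = v := by
  rw [WordComplement.len_mul, WordComplement.len_gen] at hN
  exact hR.cancel (by omega) e

end Reduction

variable (k) in
/-- The cube condition for a triple of letters. -/
def CubeAt (N : ℕ) (a b c : Gen n) : Prop :=
  ∀ w w' : (κ).Mon, (κ).len (ρ c a * w) ≤ N → ρ c a * w = ρ c b * w' →
    ∃ z, ρ a c * w = ρ a b * z ∧ ρ b c * w' = ρ b a * z

theorem CubeAt.symm {N : ℕ} {a b c : Gen n} (h : CubeAt k N a b c) : CubeAt k N b a c := by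
  intro w w' hN e
  obtain ⟨z, h₁, h₂⟩ := h w' w (e ▸ hN) e.symm
  exact ⟨z, h₂, h₁⟩

section Cubes

variable {N : ℕ} (hR : (complement n k).RedUpTo N) {a b c : Gen n}
include hR

theorem cubeAt_self_left : CubeAt k N a a c := by
  intro w w' hN e
  have hC : ∀ (d : Gen n) (w w' : (κ).Mon), (κ).len (γ d * w) ≤ N →
      γ d * w = γ d * w' → w = w' := fun d w w' h₁ h₂ => cancel hR h₂ h₁
  obtain rfl : w = w' := by
    rcases letters_cases c a with rfl | h | h | ⟨i, j, rfl, rfl, h⟩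
    · simpa using e
    · rw [res_adj h, mul_assoc] at hN e
      rw [mul_assoc] at e
      refine hC _ _ _ ?_ (hC _ _ _ hN e)
      simp only [WordComplement.len_mul] at hN ⊢
      omega
    · rw [res_far h] at hN e
      exact hC _ _ _ hN e
    · rw [res_inl h] at hN e
      exact hC _ _ _ hN e
  exact ⟨ρ a c * w, by simp, by simp⟩

omit hR in
theorem cubeAt_self_right : CubeAt k N a b a := by
  intro w w' _ e
  rw [WordComplement.res_self, one_mul] at e
  exact ⟨w', by simpa using e, rfl⟩

theorem cubeAt_far_far_far (hab : Far a b) (hac : Far a c) (hbc : Far b c) :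
    CubeAt k N a b c := by
  intro w w' hN e
  rw [res_far hac.symm] at hN e
  rw [res_far hbc.symm] at e
  obtain ⟨z, rfl, rfl⟩ := red_far hR hab e hN
  rw [res_far hab, res_far hab.symm, res_far hac, res_far hbc]
  exact ⟨γ c * z, comm hbc.symm z, comm hac.symm z⟩

theorem cubeAt_adj_far_far (hab : Adj a b) (hac : Far a c) (hbc : Far b c) :
    CubeAt k N a b c := by
  intro w w' hN e
  rw [res_far hac.symm] at hN e
  rw [res_far hbc.symm] at e
  obtain ⟨z, rfl, rfl⟩ := red_adj hR hab e hN
  rw [res_adj hab, res_adj hab.symm, res_far hac, res_far hbc]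
  refine ⟨γ c * z, ?_, ?_⟩
  · rw [mul_assoc, comm hac z, comm hbc]
  · rw [mul_assoc, comm hbc z, comm hac]

theorem cubeAt_far_adj_far (hab : Far a b) (hac : Adj a c) (hbc : Far b c) :
    CubeAt k N a b c := by
  intro w w' hN e
  rw [res_adj hac.symm, mul_assoc] at hN e
  rw [res_far hbc.symm] at e
  obtain ⟨z, e', rfl⟩ := red_far hR hab e hN
  rw [WordComplement.len_mul] at hN
  obtain ⟨y, rfl, rfl⟩ := red_far hR hbc.symm e' (by omega)
  rw [res_far hab, res_far hab.symm, res_adj hac, res_far hbc]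
  refine ⟨γ c * (γ a * y), ?_, ?_⟩
  · rw [mul_assoc, comm hab, comm hbc]
  · rw [braid hac]

theorem cubeAt_far_adj_adj (hab : Far a b) (hac : Adj a c) (hbc : Adj b c) :
    CubeAt k N a b c := by
  intro w w' hN e
  rw [res_adj hac.symm, mul_assoc] at hN e
  rw [res_adj hbc.symm, mul_assoc] at e
  obtain ⟨z, e₁, e₂⟩ := red_far hR hab e hN
  rw [WordComplement.len_mul] at hN
  obtain ⟨y, rfl, rfl⟩ := red_adj hR hbc.symm e₁ (by omega)
  have hN₂ : (κ).len (γ c * w') ≤ N := by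
    rw [e₂]
    simp only [WordComplement.len_mul, WordComplement.len_gen] at hN ⊢
    omega
  obtain ⟨x, rfl, e₃⟩ := red_adj hR hac.symm e₂ hN₂
  have e₄ := cancel hR e₃
    (by simp only [WordComplement.len_mul, WordComplement.len_gen] at hN ⊢; omega)
  obtain ⟨q, rfl, rfl⟩ := red_far hR hab.symm e₄
    (by simp only [WordComplement.len_mul, WordComplement.len_gen] at hN ⊢; omega)
  rw [res_far hab, res_far hab.symm, res_adj hac, res_adj hbc]
  refine ⟨γ c * (γ b * (γ a * (γ c * q))), ?_, ?_⟩
  · rw [mul_assoc, comm hab, braid hac, braid hbc.symm]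
  · rw [mul_assoc, comm hab.symm, braid hbc, braid hac.symm, comm hab]

theorem cubeAt_adj_adj_far (hab : Adj a b) (hac : Adj a c) (hbc : Far b c) :
    CubeAt k N a b c := by
  intro w w' hN e
  rw [res_adj hac.symm, mul_assoc] at hN e
  rw [res_far hbc.symm] at e
  obtain ⟨z, e₁, rfl⟩ := red_adj hR hab e hN
  rw [WordComplement.len_mul] at hN
  obtain ⟨y, rfl, e₂⟩ := red_far hR hbc.symm e₁ (by omega)
  have hN₂ : (κ).len (γ a * z) ≤ N := by
    rw [e₂]
    simp only [WordComplement.len_mul, WordComplement.len_gen] at hN ⊢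
    omega
  obtain ⟨x, rfl, rfl⟩ := red_adj hR hac e₂ hN₂
  rw [res_adj hab, res_adj hab.symm, res_adj hac, res_far hbc]
  refine ⟨γ c * (γ a * (γ b * x)), ?_, ?_⟩
  · rw [mul_assoc, mul_assoc, braid hab, comm hbc.symm, braid hac, comm hbc.symm]
  · rw [mul_assoc, comm hbc, ← braid hac, comm hbc, braid hab]

theorem cubeAt_inl_inl_inl {i j l : ℤ} (hij : i ≠ j) (hil : i ≠ l) (hjl : j ≠ l) :
    CubeAt (n := n) k N (.inl i) (.inl j) (.inl l) := by
  intro w w' hN e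
  rw [res_inl hil.symm] at hN e
  rw [res_inl hjl.symm] at e
  obtain rfl := cancel hR e hN
  rw [res_inl hij, res_inl hij.symm, res_inl hil, res_inl hjl]
  exact ⟨w, rfl, rfl⟩

theorem cubeAt_inl_inl_far {i j : ℤ} (hij : i ≠ j) (hc : ∀ i, Far (.inl i) c) :
    CubeAt k N (.inl i) (.inl j) c := by
  intro w w' hN e
  rw [res_far (hc i).symm] at hN e
  rw [res_far (hc j).symm] at e
  obtain ⟨z, rfl, rfl⟩ := red_inl hR hij e hN
  rw [res_inl hij, res_inl hij.symm, res_far (hc i), res_far (hc j)]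
  exact ⟨γ c * z, comm (hc _).symm z, comm (hc _).symm z⟩

theorem cubeAt_inl_far_inl {i l : ℤ} (hil : i ≠ l) (hb : ∀ i, Far (.inl i) b) :
    CubeAt k N (.inl i) b (.inl l) := by
  intro w w' hN e
  rw [res_inl hil.symm] at hN e
  rw [res_far (hb l)] at e
  obtain ⟨z, rfl, rfl⟩ := red_far hR (hb _) e hN
  rw [res_inl hil, res_far (hb l).symm, res_far (hb i), res_far (hb i).symm]
  exact ⟨γ (.inl (i - k)) * z, comm (hb _) z, shift _ _ z⟩

theorem cubeAt_inl_inl_adj {i j : ℤ} (hij : i ≠ j) (hc : ∀ i, Adj (.inl i) c) :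
    CubeAt k N (.inl i) (.inl j) c := by
  intro w w' hN e
  rw [res_adj (hc i).symm, mul_assoc] at hN e
  rw [res_adj (hc j).symm, mul_assoc] at e
  obtain ⟨z, e₁, e₂⟩ := red_inl hR hij e hN
  rw [WordComplement.len_mul] at hN
  obtain ⟨y, rfl, rfl⟩ := red_adj hR (hc _).symm e₁ (by omega)
  have hN₂ : (κ).len (γ c * w') ≤ N := by
    rw [e₂]
    simp only [WordComplement.len_mul, WordComplement.len_gen] at hN ⊢
    omega
  obtain ⟨x, rfl, e₃⟩ := red_adj hR (hc _).symm e₂ hN₂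
  have e₄ := cancel hR e₃
    (by simp only [WordComplement.len_mul, WordComplement.len_gen] at hN ⊢; omega)
  obtain ⟨q, rfl, rfl⟩ := red_inl hR (by omega) e₄
    (by simp only [WordComplement.len_mul, WordComplement.len_gen] at hN ⊢; omega)
  have key : ∀ i : ℤ, γ c * (γ (.inl i) * (γ (.inl (i - k)) * (γ c * (γ (.inl (i - k - k)) * q))))
      = γ (.inl (i - k)) * (γ c * (γ (.inl i) * (γ (.inl (i - k)) * (γ c * q)))) := by
    intro i
    rw [shift i (i - k), braid (hc (i - k - k)), braid (hc _).symm, shift (i - k) i]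
  rw [res_inl hij, res_inl hij.symm, res_adj (hc i), res_adj (hc j)]
  refine ⟨γ c * (γ (.inl i) * (γ (.inl (i - k)) * (γ c * q))), ?_, ?_⟩
  · rw [mul_assoc, key]
  · rw [mul_assoc, key, shift j i]

theorem cubeAt_inl_adj_inl (hk : k ≠ 0) {i l : ℤ} (hil : i ≠ l) (hb : ∀ i, Adj (.inl i) b) :
    CubeAt k N (.inl i) b (.inl l) := by
  intro w w' hN e
  rw [res_inl hil.symm] at hN e
  rw [res_adj (hb l), mul_assoc] at e
  obtain ⟨z, rfl, e₁⟩ := red_adj hR (hb _) e hN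
  have hN₂ : (κ).len (γ (.inl l) * w') ≤ N := by
    rw [e₁]
    simp only [WordComplement.len_mul, WordComplement.len_gen] at hN ⊢
    omega
  obtain ⟨y, rfl, e₂⟩ := red_inl hR (by omega) e₁ hN₂
  obtain ⟨x, rfl, rfl⟩ := red_adj hR (hb _).symm e₂
    (by simp only [WordComplement.len_mul, WordComplement.len_gen] at hN ⊢; omega)
  rw [res_inl hil, res_adj (hb l).symm, res_adj (hb i), res_adj (hb i).symm]
  refine ⟨γ (.inl (i - k)) * (γ b * (γ (.inl (i - k - k)) * x)), ?_, ?_⟩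
  · rw [mul_assoc, shift (l - k) (i - k), braid (hb (i - k)), ← braid (hb (i - k - k)),
      shift (i - k) i]
  · rw [mul_assoc, mul_assoc, braid (hb (l - k)).symm, braid (hb (i - k)).symm, shift l i,
      shift (l - k) (i - k)]

end Cubes

/-- The complement satisfies the cube condition. -/
theorem cube (hk : k ≠ 0) : (complement n k).Cube := by
  intro N hR a b c
  change CubeAt k N a b c
  have far_or_adj : ∀ s : SIdx n,
      (∀ i : ℤ, Adj (.inl i) (.inr s)) ∨ ∀ i : ℤ, Far (.inl i) (.inr s) := by
    intro s
    simp only [Adj, Far]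
    have := s.2.1
    rcases eq_or_ne s.val 3 with h | h
    · exact .inl fun _ => h
    · exact .inr fun _ => by omega
  have inl_inr_inl : ∀ {i l : ℤ} {s : SIdx n}, i ≠ l → CubeAt k N (.inl i) (.inr s) (.inl l) := by
    intro i l s hil
    rcases far_or_adj s with hs | hs
    · exact cubeAt_inl_adj_inl hR hk hil hs
    · exact cubeAt_inl_far_inl hR hil hs
  rcases letters_cases a b with rfl | hab | hab | ⟨i, j, rfl, rfl, hab⟩
  · exact cubeAt_self_left hR
  · rcases letters_cases a c with rfl | hac | hac | ⟨i, l, rfl, rfl, hac⟩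
    · exact cubeAt_self_right
    · rcases letters_cases b c with rfl | hbc | hbc | ⟨j, l, rfl, rfl, hbc⟩
      · exact cubeAt_self_right.symm
      · exact (not_adj_of_adj_of_adj hab hac hbc).elim
      · exact cubeAt_adj_adj_far hR hab hac hbc
      · rcases a with i | s
        · exact hab.elim
        · exact (inl_inr_inl hbc).symm
    · rcases letters_cases b c with rfl | hbc | hbc | ⟨j, l, rfl, rfl, hbc⟩
      · exact cubeAt_self_right.symm
      · exact (cubeAt_adj_adj_far hR hab.symm hbc hac).symm
      · exact cubeAt_adj_far_far hR hab hac hbc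
      · rcases a with i | s
        · exact hab.elim
        · exact (inl_inr_inl hbc).symm
    · rcases b with j | s
      · exact hab.elim
      · exact inl_inr_inl hac
  · rcases letters_cases a c with rfl | hac | hac | ⟨i, l, rfl, rfl, hac⟩
    · exact cubeAt_self_right
    · rcases letters_cases b c with rfl | hbc | hbc | ⟨j, l, rfl, rfl, hbc⟩
      · exact cubeAt_self_right.symm
      · exact cubeAt_far_adj_adj hR hab hac hbc
      · exact cubeAt_far_adj_far hR hab hac hbc
      · rcases a with i | s
        · exact hab.elim
        · exact (inl_inr_inl hbc).symm
    · rcases letters_cases b c with rfl | hbc | hbc | ⟨j, l, rfl, rfl, hbc⟩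
      · exact cubeAt_self_right.symm
      · exact (cubeAt_far_adj_far hR hab.symm hbc hac).symm
      · exact cubeAt_far_far_far hR hab hac hbc
      · rcases a with i | s
        · exact hab.elim
        · exact (inl_inr_inl hbc).symm
    · rcases b with j | s
      · exact hab.elim
      · exact inl_inr_inl hac
  · rcases c with l | s
    · rcases eq_or_ne i l with rfl | hil
      · exact cubeAt_self_right
      rcases eq_or_ne j l with rfl | hjl
      · exact cubeAt_self_right.symm
      exact cubeAt_inl_inl_inl hR hab hil hjl
    · rcases far_or_adj s with hs | hs
      · exact cubeAt_inl_inl_adj hR hab hs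
      · exact cubeAt_inl_inl_far hR hab hs

section Garside

variable {X : Type*} [Monoid X]

/-- The Jucys–Murphy type elements built from `t i` and `σ j`. -/
def jucys (k : ℤ) (t : ℤ → X) (σ : ℕ → X) : ℕ → X
  | 0 => t 0 * t (-k)
  | m + 1 => σ m * jucys k t σ m * σ m

/-- The product of the first `m` Jucys–Murphy type elements. -/
def garside (k : ℤ) (t : ℤ → X) (σ : ℕ → X) : ℕ → X
  | 0 => 1
  | m + 1 => garside k t σ m * jucys k t σ m

/-- The relations satisfied by `t̃_i` and `σ j = s̃_{j+3}`, where only the `σ j` with `j < N` are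
relevant. -/
structure Relations (k : ℤ) (t : ℤ → X) (σ : ℕ → X) (N : ℕ) : Prop where
  shift : ∀ i j, t i * t (i - k) = t j * t (j - k)
  braid_t : 0 < N → ∀ i, σ 0 * t i * σ 0 = t i * σ 0 * t i
  braid : ∀ j, j + 1 < N → σ j * σ (j + 1) * σ j = σ (j + 1) * σ j * σ (j + 1)
  comm_t : ∀ i j, Commute (σ (j + 1)) (t i)
  comm : ∀ i j, i + 1 < j → Commute (σ i) (σ j)

namespace Relations

variable {k : ℤ} {t : ℤ → X} {σ : ℕ → X} {N : ℕ} (h : Relations k t σ N)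
include h

local notation "J" => jucys k t σ
local notation "P" => garside k t σ

theorem jucys_zero (i : ℤ) : J 0 = t i * t (i - k) := by
  rw [h.shift i 0, zero_sub, jucys]

theorem t_mul_jucys_zero (i : ℤ) : t i * J 0 = J 0 * t (i - k - k) := by
  conv_lhs => rw [h.jucys_zero (i - k), ← mul_assoc, ← h.jucys_zero]

theorem t_mul_jucys_succ {m : ℕ} (hm : m < N) (i : ℤ) :
    t i * J (m + 1) = J (m + 1) * t (i - k) := by
  induction m with
  | zero =>
    have e := h.braid_t hm
    calc t i * J 1 = (t i * σ 0 * t i) * (t (i - k) * σ 0) := by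
          rw [jucys, h.jucys_zero i]; simp only [mul_assoc]
      _ = σ 0 * t i * (σ 0 * t (i - k) * σ 0) := by rw [← e]; simp only [mul_assoc]
      _ = J 1 * t (i - k) := by
          rw [e, jucys, h.jucys_zero i]; simp only [mul_assoc]
  | succ m ih =>
    rw [jucys, ← mul_assoc, ← mul_assoc, ← (h.comm_t i m).eq, mul_assoc (σ _), ih (by omega),
      ← mul_assoc, mul_assoc, ← (h.comm_t _ m).eq, mul_assoc _ (σ (m + 1)) (t _)]

theorem commute_jucys_of_lt {j m : ℕ} (hj : m < j) : Commute (σ j) (J m) := by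
  induction m with
  | zero =>
    obtain ⟨j, rfl⟩ := Nat.exists_eq_succ_of_ne_zero hj.ne'
    exact (h.comm_t _ _).mul_right (h.comm_t _ _)
  | succ m ih =>
    have := (h.comm m j hj).symm
    exact (this.mul_right (ih (by omega))).mul_right this

theorem commute_jucys_of_add_two_le {j m : ℕ} (hj : j + 2 ≤ m) (hm : m ≤ N) :
    Commute (σ j) (J m) := by
  induction m, hj using Nat.le_induction with
  | base =>
    have e := h.braid j hm
    have c := (h.commute_jucys_of_lt (Nat.lt_succ_self j)).eq
    calc σ j * J (j + 2) = (σ j * σ (j + 1) * σ j) * J j * σ j * σ (j + 1) := by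
          simp only [jucys, mul_assoc]
      _ = σ (j + 1) * σ j * (σ (j + 1) * J j) * σ j * σ (j + 1) := by
          rw [e]; simp only [mul_assoc]
      _ = σ (j + 1) * σ j * J j * (σ (j + 1) * σ j * σ (j + 1)) := by
          rw [c]; simp only [mul_assoc]
      _ = J (j + 2) * σ j := by
          rw [← e]; simp only [jucys, mul_assoc]
  | succ m hjm ih =>
    have := h.comm j m hjm
    exact (this.mul_right (ih (by omega))).mul_right this

theorem commute_jucys_jucys {i m : ℕ} (him : i < m) (hm : m ≤ N) : Commute (J i) (J m) := by
  induction i with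
  | zero =>
    obtain ⟨m, rfl⟩ := Nat.exists_eq_succ_of_ne_zero him.ne'
    calc J 0 * J (m + 1) = J (m + 1) * (t (0 - k) * t (0 - k - k)) := by
          rw [h.jucys_zero 0, mul_assoc, h.t_mul_jucys_succ hm, ← mul_assoc,
            h.t_mul_jucys_succ hm, mul_assoc]
      _ = J (m + 1) * J 0 := by rw [h.jucys_zero (0 - k)]
  | succ i ih =>
    have := h.commute_jucys_of_add_two_le him hm
    exact (this.mul_left (ih (by omega))).mul_left this

theorem commute_garside_jucys {i m : ℕ} (him : i ≤ m) (hm : m ≤ N) : Commute (P i) (J m) := by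
  induction i with
  | zero => exact Commute.one_left _
  | succ i ih => exact (ih (by omega)).mul_left (h.commute_jucys_jucys him hm)

theorem commute_garside_of_le {j m : ℕ} (hj : m ≤ j) : Commute (σ j) (P m) := by
  induction m with
  | zero => exact Commute.one_right _
  | succ m ih => exact (ih (by omega)).mul_right (h.commute_jucys_of_lt hj)

theorem commute_garside {j m : ℕ} (hj : j + 1 < m) (hm : m ≤ N + 1) : Commute (σ j) (P m) := by
  induction m, hj using Nat.le_induction with
  | base =>
    have c := (h.commute_jucys_jucys (Nat.lt_succ_self j) (by omega)).eq
    have : Commute (σ j) (J j * J (j + 1)) := by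
      calc σ j * (J j * J (j + 1)) = J (j + 1) * J j * σ j := by
            simp only [jucys, mul_assoc]
        _ = J j * J (j + 1) * σ j := by rw [c]
    have := (h.commute_garside_of_le le_rfl).mul_right this
    rwa [← mul_assoc] at this
  | succ m hjm ih =>
    exact (ih (by omega)).mul_right (h.commute_jucys_of_add_two_le hjm (by omega))

theorem t_mul_garside {m : ℕ} (hm : m ≤ N) (i : ℤ) : ∃ l, t i * P (m + 1) = P (m + 1) * t l := by
  induction m with
  | zero => exact ⟨i - k - k, by simpa [garside] using h.t_mul_jucys_zero i⟩
  | succ m ih =>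
    obtain ⟨l, hl⟩ := ih (by omega)
    exact ⟨l - k, by rw [garside, ← mul_assoc, hl, mul_assoc, h.t_mul_jucys_succ hm, mul_assoc]⟩

theorem jucys_dvd_garside {i m : ℕ} (him : i < m) (hm : m ≤ N + 1) : J i ∣ P m := by
  induction m, him using Nat.le_induction with
  | base => exact ⟨P i, (h.commute_garside_jucys le_rfl (by omega)).eq⟩
  | succ m him ih => exact (ih (by omega)).trans (Dvd.intro _ rfl)

theorem t_dvd_garside (i : ℤ) : t i ∣ P (N + 1) :=
  .trans ⟨_, h.jucys_zero i⟩ (h.jucys_dvd_garside (Nat.succ_pos N) le_rfl)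

theorem dvd_garside {j : ℕ} (hj : j < N) : σ j ∣ P (N + 1) :=
  .trans ⟨J j * σ j, by rw [jucys, mul_assoc]⟩
    (h.jucys_dvd_garside (Nat.succ_lt_succ hj) le_rfl)

end Relations

end Garside

section Monoid

/-- A family of elements satisfying the defining relations satisfies those of the complement. -/
theorem lift_eq_of_rel {X : Type*} [Monoid X] {f : Gen n → X}
    (hadj : ∀ a b, Adj a b → f a * f b * f a = f b * f a * f b)
    (hfar : ∀ a b, Far a b → f a * f b = f b * f a)
    (hshift : ∀ i j : ℤ, f (.inl i) * f (.inl (i - k)) = f (.inl j) * f (.inl (j - k))) :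
    ∀ x y, (complement n k).Rel x y → FreeMonoid.lift f x = FreeMonoid.lift f y := by
  rintro _ _ ⟨a, b, rfl, rfl⟩
  change FreeMonoid.lift f (.of a * word k a b) = FreeMonoid.lift f (.of b * word k b a)
  rcases letters_cases a b with rfl | h | h | ⟨i, j, rfl, rfl, h⟩
  · rfl
  · simpa [word_adj h, word_adj h.symm, mul_assoc] using hadj a b h
  · simpa [word_far h, word_far h.symm] using hfar a b h
  · simpa [word_inl h, word_inl h.symm] using hshift i j

/-- The involution of the letters sending `t̃_i` to `t̃_{-i}`. -/
def flip : Gen n → Gen n := Sum.map (-·) id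

theorem flip_flip (a : Gen n) : flip (flip a) = a := by
  rcases a with i | s <;> simp [flip]

theorem Adj.flip {a b : Gen n} (h : Adj a b) : Adj (flip a) (flip b) := by
  rcases a with i | s <;> rcases b with j | s' <;> exact h

theorem Far.flip {a b : Gen n} (h : Far a b) : Far (BMonoid.flip a) (BMonoid.flip b) := by
  rcases a with i | s <;> rcases b with j | s' <;> exact h

theorem gen_adj {a b : Gen n} (h : Adj a b) : γ a * γ b * γ a = γ b * γ a * γ b := by
  simpa [mul_assoc] using braid (k := k) h 1

theorem gen_far {a b : Gen n} (h : Far a b) : γ a * γ b = γ b * γ a := by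
  simpa using comm (k := k) h 1

theorem gen_shift (i j : ℤ) :
    γ (.inl i) * γ (.inl (i - k)) = γ (.inl j) * γ (.inl (j - k)) := by
  simpa using shift (n := n) (k := k) i j 1

variable (n k) in
/-- The anti-automorphism of the positive monoid extending `flip`. -/
noncomputable def rev : (complement n k).Mon →* (complement n k).Monᵐᵒᵖ :=
  PresentedMonoid.lift (fun a => .op (γ (flip a))) <| lift_eq_of_rel
    (fun a b h => by
      simp only [← MulOpposite.op_mul, ← mul_assoc]
      rw [gen_adj h.flip])
    (fun a b h => by
      simp only [← MulOpposite.op_mul]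
      rw [gen_far h.flip])
    (fun i j => by
      simp only [← MulOpposite.op_mul]
      have := gen_shift (n := n) (k := k) (-(i - k)) (-(j - k))
      exact congrArg MulOpposite.op (by simpa [flip] using this))

theorem rev_gen (a : Gen n) : rev n k (γ a) = .op (γ (flip a)) := rfl

theorem rev_rev (x : (κ).Mon) : (rev n k (rev n k x).unop).unop = x := by
  induction x using WordComplement.gen_induction with
  | one => simp
  | gen_mul a x ih => simp [ih, rev_gen, flip_flip]

theorem isCancelMul (hk : k ≠ 0) : IsCancelMul (complement n k).Mon where
  mul_left_cancel x _ _ h := (cube hk).mul_left_cancel x h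
  mul_right_cancel x y z h := by
    have := congrArg (fun x => (rev n k x).unop) h
    simp only [map_mul, MulOpposite.unop_mul] at this
    rw [← rev_rev y, (cube hk).mul_left_cancel _ this, rev_rev]

variable (n k) in
/-- The element `s̃_{j+3}` of the positive monoid, or `1` if it does not exist. -/
noncomputable def simple (j : ℕ) : (complement n k).Mon :=
  if h : j + 3 ≤ n then γ (.inr ⟨j + 3, by omega, h⟩) else 1

theorem relations : Relations k (fun i => γ (.inl i)) (simple n k) (n - 2) where
  shift := gen_shift
  braid_t h i := by
    rw [simple, dif_pos (by omega)]
    exact gen_adj rfl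
  braid j h := by
    rw [simple, simple, dif_pos (by omega), dif_pos (by omega)]
    exact gen_adj (.inl rfl)
  comm_t i j := by
    rw [simple]
    split_ifs
    · exact gen_far (show 4 ≤ j + 1 + 3 by omega)
    · exact .one_left _
  comm i j h := by
    rw [simple, simple]
    split_ifs
    · exact gen_far (.inl (show i + 3 + 1 < j + 3 by omega))
    all_goals simp

theorem exists_simple (s : SIdx n) : ∃ j < n - 2, γ (.inr s) = simple n k j := by
  obtain ⟨s, h₁, h₂⟩ := s
  obtain ⟨j, rfl⟩ := Nat.exists_eq_add_of_le' h₁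
  exact ⟨j, by omega, by rw [simple, dif_pos h₂]⟩

/-- Any two elements of the positive monoid have a common right multiple. -/
theorem exists_mul_eq_mul (x y : (κ).Mon) : ∃ p q, x * p = y * q := by
  have hr := relations (n := n) (k := k)
  refine WordComplement.exists_mul_eq_mul
    (garside k (fun i => γ (.inl i)) (simple n k) (n - 2 + 1)) ?_ ?_ x y
  · rintro (i | s)
    · exact hr.t_dvd_garside i
    · obtain ⟨j, hj, e⟩ := exists_simple (k := k) s
      exact e ▸ hr.dvd_garside hj
  · rintro (i | s)
    · obtain ⟨l, hl⟩ := hr.t_mul_garside le_rfl i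
      exact ⟨_, hl⟩
    · obtain ⟨j, hj, e⟩ := exists_simple (k := k) s
      exact ⟨_, e ▸ (hr.commute_garside (Nat.succ_lt_succ hj) le_rfl).eq⟩

/-- Any two elements of the positive monoid have a common left multiple. -/
theorem exists_mul_eq_mul' (x y : (κ).Mon) : ∃ p q, p * x = q * y := by
  obtain ⟨p, q, h⟩ := exists_mul_eq_mul (rev n k x).unop (rev n k y).unop
  refine ⟨(rev n k p).unop, (rev n k q).unop, ?_⟩
  have := congrArg (fun x => (rev n k x).unop) h
  simpa only [map_mul, MulOpposite.unop_mul, rev_rev] using this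

end Monoid

section Group

open PresentedGroup (mk_eq_mk_of_mul_inv_mem)

variable (n k) in
/-- The homomorphism from the positive monoid to the group. -/
noncomputable def toBGrp : (complement n k).Mon →* BGrp n k :=
  PresentedMonoid.lift PresentedGroup.of <| lift_eq_of_rel
    (fun a b h => by
      rcases a with i | s <;> rcases b with j | s'
      · exact h.elim
      · exact (mk_eq_mk_of_mul_inv_mem (.inr (.inr (.inl ⟨i, s', h, rfl⟩)))).symm
      · exact mk_eq_mk_of_mul_inv_mem (.inr (.inr (.inl ⟨j, s, h, rfl⟩)))
      · exact mk_eq_mk_of_mul_inv_mem (.inl ⟨s, s', h, rfl⟩))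
    (fun a b h => by
      rcases a with i | s <;> rcases b with j | s'
      · exact h.elim
      · exact (mk_eq_mk_of_mul_inv_mem (.inr (.inr (.inr (.inl ⟨i, s', h, rfl⟩))))).symm
      · exact mk_eq_mk_of_mul_inv_mem (.inr (.inr (.inr (.inl ⟨j, s, h, rfl⟩))))
      · exact mk_eq_mk_of_mul_inv_mem (.inr (.inl ⟨s, s', h, rfl⟩)))
    (fun i j => mk_eq_mk_of_mul_inv_mem (.inr (.inr (.inr (.inr ⟨i, j, rfl⟩)))))

theorem toBGrp_gen (a : Gen n) : toBGrp n k (γ a) = PresentedGroup.of a := rfl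

/-- A homomorphism from the positive monoid to a group extends to `BGrp n k`. -/
theorem exists_extension {G : Type*} [Group G] (φ : (complement n k).Mon →* G) :
    ∃ ψ : BGrp n k →* G, ∀ x, ψ (toBGrp n k x) = φ x := by
  have hrel : ∀ r ∈ BRels n k, FreeGroup.lift (fun a => φ (γ a)) r = 1 := by
    rintro _ (⟨s, s', h, rfl⟩ | ⟨s, s', h, rfl⟩ | ⟨i, s, h, rfl⟩ | ⟨i, s, h, rfl⟩ | ⟨i, j, rfl⟩)
    all_goals
      rw [map_mul, map_inv, mul_inv_eq_one]
      simp only [gs, gt, map_mul, FreeGroup.lift_apply_of]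
      simp only [← map_mul]
      congr 1
    · exact gen_adj h
    · exact gen_far h
    · exact gen_adj h
    · exact gen_far h
    · exact gen_shift i j
  refine ⟨PresentedGroup.toGroup hrel, fun x => ?_⟩
  induction x using WordComplement.gen_induction with
  | one => simp
  | gen_mul a x ih => rw [map_mul, map_mul, map_mul, ih, toBGrp_gen, PresentedGroup.toGroup.of]

theorem toBGrp_injective (hk : k ≠ 0) : Function.Injective (toBGrp n k) := by
  have := isCancelMul (n := n) hk
  obtain ⟨Q, _, φ, hφ⟩ := exists_injective_units (exists_mul_eq_mul' (n := n) (k := k))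
  obtain ⟨ψ, hψ⟩ := exists_extension φ
  exact .of_comp (f := ψ) (by simpa only [Function.comp_def, hψ] using hφ)

theorem exists_toBGrp_mul_eq (g : BGrp n k) : ∃ d a, toBGrp n k d * g = toBGrp n k a := by
  have hg : g ∈ Subgroup.closure (Set.range (PresentedGroup.of (rels := BRels n k))) := by
    rw [PresentedGroup.closure_range_of]; trivial
  induction hg using Subgroup.closure_induction with
  | mem g hg =>
    obtain ⟨a, rfl⟩ := hg
    exact ⟨1, γ a, by rw [map_one, one_mul, toBGrp_gen]⟩
  | one => exact ⟨1, 1, by simp⟩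
  | mul g g' _ _ ih ih' =>
    obtain ⟨d, a, h⟩ := ih
    obtain ⟨d', a', h'⟩ := ih'
    obtain ⟨p, q, hpq⟩ := exists_mul_eq_mul' a d'
    refine ⟨p * d, q * a', ?_⟩
    rw [map_mul, map_mul, ← h', ← mul_assoc, mul_assoc _ _ g, h, ← map_mul, hpq, map_mul,
      mul_assoc]
  | inv g _ ih =>
    obtain ⟨d, a, h⟩ := ih
    exact ⟨a, d, by rw [← h, mul_inv_cancel_right]⟩

end Group

end BMonoid

/-- the group `B^{(k)}(∞,∞,n)` is torsion-free. -/
theorem stmt_16 (n : ℕ) (hn : 2 ≤ n) (k : ℤ) (hk : k ≠ 0)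
    (g : BGrp n k) (m : ℕ) (hm : m ≠ 0) (h : g ^ m = 1) : g = 1 :=
  eq_one_of_pow_eq_one_of_fractions (BMonoid.toBGrp n k) (BMonoid.toBGrp_injective hk)
    BMonoid.exists_toBGrp_mul_eq BMonoid.exists_mul_eq_mul'
    (fun x y => by
      obtain ⟨p, q, e⟩ := BMonoid.exists_mul_eq_mul x y
      exact (BMonoid.cube hk).exists_lcm ⟨p, rfl⟩ ⟨q, e⟩)
    (fun _ _ => WordComplement.eq_one_of_pow_eq_one) hm h
end

section
/- For every n ≥ 3 and every integer k ≥ 1, the group B^{(k)}(∞,∞,n) is isomorphic to the amalgamated free product (pushout) over the index set {0,1,…,k−1} of k copies of B(∞,∞,n) = B^{(1)}(∞,∞,n), all amalgamated along the Artin group B(B_{n−1}), where for each index the amalgamating homomorphism B(B_{n−1}) → B(∞,∞,n) is the one sending q_1 to t̃_1·t̃_0 and q_{j−1} to s̃_j for 3 ≤ j ≤ n. -/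
/-- Families `T : ℤ → G` and `S : SIdx n → G` satisfying the defining relations of
`B^{(k)}(∞,∞,n)`. -/
structure SatisfiesBRels (n : ℕ) (k : ℤ) {G : Type*} [Group G] (T : ℤ → G) (S : SIdx n → G) :
    Prop where
  braid : ∀ i j : SIdx n, (i.val + 1 = j.val ∨ j.val + 1 = i.val) →
    S i * S j * S i = S j * S i * S j
  comm : ∀ i j : SIdx n, (i.val + 1 < j.val ∨ j.val + 1 < i.val) → S i * S j = S j * S i
  braid_three : ∀ (i : ℤ) (j : SIdx n), j.val = 3 → S j * T i * S j = T i * S j * T i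
  comm_of_four_le : ∀ (i : ℤ) (j : SIdx n), 4 ≤ j.val → S j * T i = T i * S j
  mul_sub : ∀ i j : ℤ, T i * T (i - k) = T j * T (j - k)

namespace SatisfiesBRels

variable {n : ℕ} {k : ℤ} {G : Type*} [Group G] {T : ℤ → G} {S : SIdx n → G}

theorem lift_eq_one (h : SatisfiesBRels n k T S) :
    ∀ r ∈ BRels n k, FreeGroup.lift (Sum.elim T S) r = 1 := by
  rintro r (⟨i, j, hij, rfl⟩ | ⟨i, j, hij, rfl⟩ | ⟨i, j, hj, rfl⟩ | ⟨i, j, hj, rfl⟩ | ⟨i, j, rfl⟩) <;>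
    rw [map_mul, map_inv, mul_inv_eq_one] <;>
    simp only [gt, gs, map_mul, FreeGroup.lift_apply_of, Sum.elim_inl, Sum.elim_inr]
  · exact h.braid i j hij
  · exact h.comm i j hij
  · exact h.braid_three i j hj
  · exact h.comm_of_four_le i j hj
  · exact h.mul_sub i j

/-- The homomorphism out of `B^{(k)}(∞,∞,n)` determined by the images of the generators. -/
def toHom (h : SatisfiesBRels n k T S) : BGrp n k →* G :=
  PresentedGroup.toGroup h.lift_eq_one

@[simp]
theorem toHom_bgt (h : SatisfiesBRels n k T S) (i : ℤ) : h.toHom (bgt n k i) = T i :=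
  PresentedGroup.toGroup.of h.lift_eq_one

@[simp]
theorem toHom_bgs (h : SatisfiesBRels n k T S) (j : SIdx n) : h.toHom (bgs n k j) = S j :=
  PresentedGroup.toGroup.of h.lift_eq_one

end SatisfiesBRels

theorem satisfiesBRels_generators (n : ℕ) (k : ℤ) : SatisfiesBRels n k (bgt n k) (bgs n k) where
  braid i j hij := PresentedGroup.mk_eq_mk_of_mul_inv_mem (.inl ⟨i, j, hij, rfl⟩)
  comm i j hij := PresentedGroup.mk_eq_mk_of_mul_inv_mem (.inr (.inl ⟨i, j, hij, rfl⟩))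
  braid_three i j hj :=
    PresentedGroup.mk_eq_mk_of_mul_inv_mem (.inr (.inr (.inl ⟨i, j, hj, rfl⟩)))
  comm_of_four_le i j hj :=
    PresentedGroup.mk_eq_mk_of_mul_inv_mem (.inr (.inr (.inr (.inl ⟨i, j, hj, rfl⟩))))
  mul_sub i j := PresentedGroup.mk_eq_mk_of_mul_inv_mem (.inr (.inr (.inr (.inr ⟨i, j, rfl⟩))))

theorem BGrp.hom_ext {n : ℕ} {k : ℤ} {G : Type*} [Group G] {f g : BGrp n k →* G}
    (ht : ∀ i, f (bgt n k i) = g (bgt n k i)) (hs : ∀ j, f (bgs n k j) = g (bgs n k j)) :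
    f = g :=
  PresentedGroup.ext fun x => match x with
    | .inl i => ht i
    | .inr j => hs j

/-- The generators `t̃_{r + k m}` (`m ∈ ℤ`) of `B^{(k)}(∞,∞,n)` satisfy the relations of
`B(∞,∞,n)`. -/
theorem satisfiesBRels_residue (n : ℕ) (k r : ℤ) :
    SatisfiesBRels n 1 (fun m => bgt n k (r + k * m)) (bgs n k) where
  braid := (satisfiesBRels_generators n k).braid
  comm := (satisfiesBRels_generators n k).comm
  braid_three _ := (satisfiesBRels_generators n k).braid_three _
  comm_of_four_le _ := (satisfiesBRels_generators n k).comm_of_four_le _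
  mul_sub i j := by
    have h := (satisfiesBRels_generators n k).mul_sub (r + k * i) (r + k * j)
    simpa only [mul_sub, mul_one, add_sub_assoc] using h

/-- The residue class of an integer modulo `k`, as an element of `Fin k`. -/
def residueFin (k : ℕ) (hk : 1 ≤ k) (i : ℤ) : Fin k :=
  ⟨(i % k).toNat, by
    have := Int.emod_lt_of_pos i (show (0 : ℤ) < k by omega)
    omega⟩

theorem coe_residueFin (k : ℕ) (hk : 1 ≤ k) (i : ℤ) : ((residueFin k hk i : ℕ) : ℤ) = i % k :=
  Int.toNat_of_nonneg (Int.emod_nonneg i (by omega))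

theorem residueFin_add_mul (k : ℕ) (hk : 1 ≤ k) (r : Fin k) (m : ℤ) :
    residueFin k hk (r + k * m) = r := by
  apply Fin.ext
  have h := coe_residueFin k hk (r + k * m)
  rw [Int.add_mul_emod_self_left, Int.emod_eq_of_lt (by omega) (by omega)] at h
  exact_mod_cast h

theorem add_mul_ediv_of_fin (k : ℕ) (hk : 1 ≤ k) (r : Fin k) (m : ℤ) :
    ((r : ℤ) + k * m) / k = m := by
  rw [Int.add_mul_ediv_left _ _ (by omega), Int.ediv_eq_zero_of_lt (by omega) (by omega), zero_add]

theorem residueFin_sub_self (k : ℕ) (hk : 1 ≤ k) (i : ℤ) :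
    residueFin k hk (i - k) = residueFin k hk i := by
  simp [residueFin]

theorem sub_self_ediv (k : ℕ) (hk : 1 ≤ k) (i : ℤ) : (i - k) / (k : ℤ) = i / k - 1 := by
  rw [Int.sub_ediv_of_dvd _ (dvd_refl _), Int.ediv_self (by omega)]

section Pushout

open Monoid

variable {n : ℕ} {k : ℕ} {φ : ArtinB n →* BGrp n 1}

theorem of_bgs_eq_of_bgs
    (hφ2 : ∀ (i : QIdx n) (h : 2 ≤ i.val),
      φ (PresentedGroup.of i) =
        bgs n 1 ⟨i.val + 1, by obtain ⟨h1, h2⟩ := i.2; omega⟩)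
    (r r' : Fin k) (j : SIdx n) :
    (PushoutI.of r (bgs n 1 j) : PushoutI (fun _ : Fin k => φ)) = PushoutI.of r' (bgs n 1 j) := by
  have h := hφ2 ⟨j.val - 1, by have := j.2; omega⟩ (by have := j.2; simp only; omega)
  have hj : (⟨j.val - 1 + 1, by have := j.2; omega⟩ : SIdx n) = j :=
    Subtype.ext (by have := j.2; simp only; omega)
  simp only [hj] at h
  rw [← h, PushoutI.of_apply_eq_base (fun _ : Fin k => φ) r,
    PushoutI.of_apply_eq_base (fun _ : Fin k => φ) r']

theorem of_bgt_mul_bgt_eq (hn : 3 ≤ n)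
    (hφ1 : ∀ i : QIdx n, i.val = 1 →
      φ (PresentedGroup.of i) = bgt n 1 1 * bgt n 1 0)
    (r r' : Fin k) (m m' : ℤ) :
    (PushoutI.of r (bgt n 1 m * bgt n 1 (m - 1)) : PushoutI (fun _ : Fin k => φ)) =
      PushoutI.of r' (bgt n 1 m' * bgt n 1 (m' - 1)) := by
  have h := hφ1 ⟨1, by omega⟩ rfl
  have ht (m : ℤ) : bgt n 1 m * bgt n 1 (m - 1) = φ (PresentedGroup.of ⟨1, by omega⟩) :=
    ((satisfiesBRels_generators n 1).mul_sub m 1).trans h.symm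
  rw [ht, ht, PushoutI.of_apply_eq_base (fun _ : Fin k => φ) r,
    PushoutI.of_apply_eq_base (fun _ : Fin k => φ) r']

theorem satisfiesBRels_pushout (hn : 3 ≤ n) (hk : 1 ≤ k)
    (hφ1 : ∀ i : QIdx n, i.val = 1 →
      φ (PresentedGroup.of i) = bgt n 1 1 * bgt n 1 0)
    (hφ2 : ∀ (i : QIdx n) (h : 2 ≤ i.val),
      φ (PresentedGroup.of i) =
        bgs n 1 ⟨i.val + 1, by obtain ⟨h1, h2⟩ := i.2; omega⟩) :
    SatisfiesBRels n k
      (fun i => (PushoutI.of (residueFin k hk i) (bgt n 1 (i / k)) :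
        PushoutI (fun _ : Fin k => φ)))
      (fun j => PushoutI.of ⟨0, hk⟩ (bgs n 1 j)) where
  braid i j hij := by
    simp only [← map_mul, (satisfiesBRels_generators n 1).braid i j hij]
  comm i j hij := by
    simp only [← map_mul, (satisfiesBRels_generators n 1).comm i j hij]
  braid_three i j hj := by
    rw [of_bgs_eq_of_bgs hφ2 _ (residueFin k hk i)]
    simp only [← map_mul, (satisfiesBRels_generators n 1).braid_three _ j hj]
  comm_of_four_le i j hj := by
    rw [of_bgs_eq_of_bgs hφ2 _ (residueFin k hk i)]
    simp only [← map_mul, (satisfiesBRels_generators n 1).comm_of_four_le _ j hj]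
  mul_sub i j := by
    simp only [residueFin_sub_self, sub_self_ediv k hk, ← map_mul]
    exact of_bgt_mul_bgt_eq hn hφ1 _ _ _ _

theorem residue_toHom_comp_eq
    (hφ1 : ∀ i : QIdx n, i.val = 1 →
      φ (PresentedGroup.of i) = bgt n 1 1 * bgt n 1 0)
    (hφ2 : ∀ (i : QIdx n) (h : 2 ≤ i.val),
      φ (PresentedGroup.of i) =
        bgs n 1 ⟨i.val + 1, by obtain ⟨h1, h2⟩ := i.2; omega⟩)
    (k r r' : ℤ) :
    (satisfiesBRels_residue n k r).toHom.comp φ = (satisfiesBRels_residue n k r').toHom.comp φ := by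
  refine PresentedGroup.ext fun i => ?_
  rcases Nat.lt_or_ge i.val 2 with hi | hi
  · have h := (satisfiesBRels_generators n k).mul_sub (r + k) (r' + k)
    simpa [hφ1 i (by have := i.2; omega)] using h
  · simp [hφ2 i hi]

end Pushout

open Monoid in
/-- for `k ≥ 1`, the group `B^{(k)}(∞,∞,n)` is isomorphic to the pushout
(amalgamated free product) of `k` copies of `B(∞,∞,n) = B^{(1)}(∞,∞,n)` along the Artin
group `B(B_{n-1})`, each amalgamating map `φ : B(B_{n-1}) → B(∞,∞,n)` being the one with
`φ(q_1) = t̃_1 t̃_0` and `φ(q_{j-1}) = s̃_j` for `3 ≤ j ≤ n`. -/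
theorem stmt_17 (n : ℕ) (hn : 3 ≤ n) (k : ℕ) (hk : 1 ≤ k)
    (φ : ArtinB n →* BGrp n 1)
    (hφ1 : ∀ i : QIdx n, i.val = 1 →
      φ (PresentedGroup.of i) = bgt n 1 1 * bgt n 1 0)
    (hφ2 : ∀ (i : QIdx n) (h : 2 ≤ i.val),
      φ (PresentedGroup.of i) =
        bgs n 1 ⟨i.val + 1, by obtain ⟨h1, h2⟩ := i.2; omega⟩) :
    Nonempty (BGrp n (k : ℤ) ≃* PushoutI (fun _ : Fin k => φ)) := by
  let f := (satisfiesBRels_pushout hn hk hφ1 hφ2).toHom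
  let g : PushoutI (fun _ : Fin k => φ) →* BGrp n k :=
    PushoutI.lift (fun r => (satisfiesBRels_residue n k (r : ℕ)).toHom)
      ((satisfiesBRels_residue n k 0).toHom.comp φ)
      (fun r => residue_toHom_comp_eq hφ1 hφ2 k (r : ℕ) 0)
  have : Nonempty (Fin k) := ⟨⟨0, hk⟩⟩
  refine ⟨MonoidHom.toMulEquiv f g ?_ ?_⟩
  · refine BGrp.hom_ext (fun i => ?_) (fun j => ?_)
    · simp [f, g, coe_residueFin, Int.emod_add_mul_ediv]
    · simp [f, g]
  · refine PushoutI.hom_ext_nonempty fun r => BGrp.hom_ext (fun m => ?_) (fun j => ?_)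
    · simp [f, g, residueFin_add_mul, add_mul_ediv_of_fin k hk]
    · simpa [f, g] using of_bgs_eq_of_bgs hφ2 _ r j
end
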